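/- arXiv:math/0601452 — 2 statements merged into one kernel-verified Lean document; each statement's English description precedes it below -/
import Mathlib

section
/- Let K be a field of characteristic zero, let A, B, C be finite-dimensional K-vector spaces with dim A = 2, and let r ≥ 1. The homogeneous ideal of σ_r(PA* × PB* × PC*) ⊂ P(A*⊗B*⊗C*) is generated in degree r+1 by the irreducible modules occurring in the two flattenings Λ^{r+1}(A⊗B) ⊗ Λ^{r+1}C and Λ^{r+1}(A⊗C) ⊗ Λ^{r+1}B inside S^{r+1}(A⊗B⊗C), i.e., by the (r+1)×(r+1) minors of the flattenings (A⊗B)⊗C and (A⊗C)⊗B; the redundancy in this description (the intersection of the two spaces of minors) is the irreducible module S^{r+1}A ⊗ Λ^{r+1}B ⊗ Λ^{r+1}C. -/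
/-!
Statement 1: for `dim A = 2`, the ideal of `σ_r(PA* × PB* × PC*)` is generated in degree
`r+1` by the `(r+1)×(r+1)` minors of the two flattenings `(A⊗B)* ⊗ C*` and
`(A⊗C)* ⊗ B*` (i.e. by the modules `Λ^{r+1}(A⊗B) ⊗ Λ^{r+1}C` and
`Λ^{r+1}(A⊗C) ⊗ Λ^{r+1}B` of `S^{r+1}(A⊗B⊗C)`); the redundancy in this description,
i.e. the intersection of the two spaces of minors, is the irreducible module
`S^{r+1}A ⊗ Λ^{r+1}B ⊗ Λ^{r+1}C`.
-/

open MvPolynomial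

/-- `T` is a sum of at most `r` decomposable tensors in `A* ⊗ B* ⊗ C*`. -/
def RankLE {K : Type} [Field K] {a b c : ℕ} (r : ℕ) (T : Fin a × Fin b × Fin c → K) :
    Prop :=
  ∃ (u : Fin r → Fin a → K) (v : Fin r → Fin b → K) (w : Fin r → Fin c → K),
    ∀ x, T x = ∑ i, u i x.1 * v i x.2.1 * w i x.2.2

/-- The homogeneous ideal of (the affine cone over) `σ_r(PA* × PB* × PC*)`. -/
noncomputable def secantIdeal (K : Type) [Field K] (a b c r : ℕ) :
    Ideal (MvPolynomial (Fin a × Fin b × Fin c) K) :=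
  ⨅ (T : Fin a × Fin b × Fin c → K) (_ : RankLE r T),
    RingHom.ker (MvPolynomial.eval T)

/-- The `(r+1)×(r+1)` minors of the flattening `(A⊗B)* ⊗ C*`; they span the module
`Λ^{r+1}(A⊗B) ⊗ Λ^{r+1}C ⊂ S^{r+1}(A⊗B⊗C)`. -/
noncomputable def minorsAB_C (K : Type) [Field K] (a b c r : ℕ) :
    Set (MvPolynomial (Fin a × Fin b × Fin c) K) :=
  { f | ∃ (ρ : Fin (r+1) → Fin a × Fin b) (γ : Fin (r+1) → Fin c),
      f = Matrix.det (Matrix.of fun i j : Fin (r+1) =>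
        (X ((ρ i).1, (ρ i).2, γ j) : MvPolynomial (Fin a × Fin b × Fin c) K)) }

/-- The `(r+1)×(r+1)` minors of the flattening `(A⊗C)* ⊗ B*`; they span the module
`Λ^{r+1}(A⊗C) ⊗ Λ^{r+1}B ⊂ S^{r+1}(A⊗B⊗C)`. -/
noncomputable def minorsAC_B (K : Type) [Field K] (a b c r : ℕ) :
    Set (MvPolynomial (Fin a × Fin b × Fin c) K) :=
  { f | ∃ (ρ : Fin (r+1) → Fin a × Fin c) (γ : Fin (r+1) → Fin b),
      f = Matrix.det (Matrix.of fun i j : Fin (r+1) =>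
        (X ((ρ i).1, γ j, (ρ i).2) : MvPolynomial (Fin a × Fin b × Fin c) K)) }

/-- A spanning set for the irreducible module
`S^{r+1}A ⊗ Λ^{r+1}B ⊗ Λ^{r+1}C ⊂ S^{r+1}(A⊗B⊗C)`: the elements obtained by
symmetrizing in the `A`-indices and skew-symmetrizing in the `B`- and `C`-indices. -/
noncomputable def symSkewSkew (K : Type) [Field K] (a b c r : ℕ) :
    Set (MvPolynomial (Fin a × Fin b × Fin c) K) :=
  { f | ∃ (α : Fin (r+1) → Fin a) (β : Fin (r+1) → Fin b) (γ : Fin (r+1) → Fin c),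
      f = ∑ σ : Equiv.Perm (Fin (r+1)), ∑ τ : Equiv.Perm (Fin (r+1)),
        ((Equiv.Perm.sign σ : ℤ) * (Equiv.Perm.sign τ : ℤ)) •
          ∏ i, (X (α i, β (σ i), γ (τ i)) : MvPolynomial (Fin a × Fin b × Fin c) K) }

section Redundancy

variable {K : Type} [Field K]

theorem exists_perm_of_prod_X_eq {σ : Type*} {k : ℕ} {p q : Fin k → σ}
    (h : ∏ i, (X (p i) : MvPolynomial σ K) = ∏ i, X (q i)) :
    ∃ π : Equiv.Perm (Fin k), p = q ∘ π := by
  classical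
  have key : ∀ p : Fin k → σ, ∏ i, (X (p i) : MvPolynomial σ K) =
      monomial (∑ i, Finsupp.single (p i) 1) 1 := fun p => by
    rw [monomial_sum_one]; rfl
  rw [key, key] at h
  have h' := monomial_left_injective one_ne_zero h
  have hcard : ∀ x, Nonempty ({i // p i = x} ≃ {i // q i = x}) := fun x => by
    refine ⟨Fintype.equivOfCardEq ?_⟩
    have := DFunLike.congr_fun h' x
    simp only [Finsupp.finsetSum_apply, Finsupp.single_apply, Finset.sum_boole] at this
    rw [Fintype.card_subtype, Fintype.card_subtype]
    exact_mod_cast this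
  exact ⟨Equiv.ofFiberEquiv fun x => (hcard x).some,
    funext fun i => (Equiv.ofFiberEquiv_map _ i).symm⟩

/-- A function of `k`-tuples of variables which does not depend on their order extends to a linear
map on polynomials. -/
theorem exists_linearMap_prod_X {σ M : Type*} [AddCommGroup M] [Module K M] {k : ℕ}
    (W : (Fin k → σ) → M) (hW : ∀ p (π : Equiv.Perm (Fin k)), W (p ∘ π) = W p) :
    ∃ L : MvPolynomial σ K →ₗ[K] M, ∀ p, L (∏ i, X (p i)) = W p := by
  classical
  refine ⟨(basisMonomials σ K).constr K fun m =>
    if h : ∃ p : Fin k → σ, ∏ i, (X (p i) : MvPolynomial σ K) = monomial m 1 then W h.choose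
    else 0, fun p => ?_⟩
  have hp : ∏ i, (X (p i) : MvPolynomial σ K) = monomial (∑ i, Finsupp.single (p i) 1) 1 := by
    rw [monomial_sum_one]; rfl
  rw [hp, show monomial (∑ i, Finsupp.single (p i) 1) (1 : K) = basisMonomials σ K _ by
    rw [coe_basisMonomials], Module.Basis.constr_basis]
  have h : ∃ q : Fin k → σ, ∏ i, (X (q i) : MvPolynomial σ K) =
    monomial (∑ i, Finsupp.single (p i) 1) 1 := ⟨p, hp⟩
  rw [dif_pos h]
  obtain ⟨π, hπ⟩ := exists_perm_of_prod_X_eq (h.choose_spec.trans hp.symm)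
  rw [hπ, hW]

variable {a b c r : ℕ}

theorem skewB_comp_perm {k : ℕ} (p : Fin k → Fin a × Fin b × Fin c)
    (π : Equiv.Perm (Fin k)) :
    ∑ σ : Equiv.Perm (Fin k), (Equiv.Perm.sign σ : ℤ) •
      ∏ i, (X ((p (π i)).1, (p (π (σ i))).2.1, (p (π i)).2.2) :
        MvPolynomial (Fin a × Fin b × Fin c) K) =
    ∑ σ : Equiv.Perm (Fin k), (Equiv.Perm.sign σ : ℤ) •
      ∏ i, X ((p i).1, (p (σ i)).2.1, (p i).2.2) := by
  refine Fintype.sum_equiv (MulAut.conj π).toEquiv _ _ fun σ => ?_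
  congr 1
  · have : MulAut.conj π σ = π * σ * π⁻¹ := rfl
    simp only [MulEquiv.toEquiv_eq_coe, MulEquiv.coe_toEquiv, this, Equiv.Perm.sign_mul,
      Equiv.Perm.sign_inv]
    rw [mul_right_comm, Int.units_mul_self, one_mul]
  · refine Fintype.prod_equiv π _ _ fun i => ?_
    simp

theorem minor_AB_C_eq {k : ℕ} (ρ : Fin k → Fin a × Fin b) (γ : Fin k → Fin c) :
    Matrix.det (Matrix.of fun i j => (X ((ρ i).1, (ρ i).2, γ j) :
      MvPolynomial (Fin a × Fin b × Fin c) K)) =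
    ∑ τ : Equiv.Perm (Fin k), (Equiv.Perm.sign τ : ℤ) •
      ∏ i, X ((ρ i).1, (ρ i).2, γ (τ i)) := by
  rw [← Matrix.det_transpose, Matrix.det_apply]
  rfl

theorem minor_AC_B_eq {k : ℕ} (ρ : Fin k → Fin a × Fin c) (β : Fin k → Fin b) :
    Matrix.det (Matrix.of fun i j => (X ((ρ i).1, β j, (ρ i).2) :
      MvPolynomial (Fin a × Fin b × Fin c) K)) =
    ∑ τ : Equiv.Perm (Fin k), (Equiv.Perm.sign τ : ℤ) •
      ∏ i, X ((ρ i).1, β (τ i), (ρ i).2) := by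
  rw [← Matrix.det_transpose, Matrix.det_apply]
  rfl

theorem symSkewSkew_subset_span_minorsAB_C :
    symSkewSkew K a b c r ⊆ Submodule.span K (minorsAB_C K a b c r) := by
  rintro f ⟨α, β, γ, rfl⟩
  refine Submodule.sum_mem _ fun σ _ => ?_
  simp_rw [mul_smul, ← Finset.smul_sum]
  have h : Matrix.det _ ∈ minorsAB_C K a b c r := ⟨fun i => (α i, β (σ i)), γ, rfl⟩
  rw [minor_AB_C_eq] at h
  exact zsmul_mem (Submodule.subset_span h) _

theorem symSkewSkew_subset_span_minorsAC_B :
    symSkewSkew K a b c r ⊆ Submodule.span K (minorsAC_B K a b c r) := by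
  rintro f ⟨α, β, γ, rfl⟩
  rw [Finset.sum_comm]
  refine Submodule.sum_mem _ fun σ _ => ?_
  simp_rw [mul_comm _ (Equiv.Perm.sign σ : ℤ), mul_smul, ← Finset.smul_sum]
  have h : Matrix.det _ ∈ minorsAC_B K a b c r := ⟨fun i => (α i, γ (σ i)), β, rfl⟩
  rw [minor_AC_B_eq] at h
  exact zsmul_mem (Submodule.subset_span h) _

theorem span_minors_inf_span_minors [CharZero K] :
    Submodule.span K (minorsAB_C K a b c r) ⊓ Submodule.span K (minorsAC_B K a b c r) =
      Submodule.span K (symSkewSkew K a b c r) := by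
  refine le_antisymm ?_ (le_inf (Submodule.span_le.2 symSkewSkew_subset_span_minorsAB_C)
    (Submodule.span_le.2 symSkewSkew_subset_span_minorsAC_B))
  obtain ⟨L, hL⟩ := exists_linearMap_prod_X (K := K)
    (fun p : Fin (r + 1) → Fin a × Fin b × Fin c =>
      ∑ σ : Equiv.Perm (Fin (r + 1)), (Equiv.Perm.sign σ : ℤ) •
        ∏ i, (X ((p i).1, (p (σ i)).2.1, (p i).2.2) : MvPolynomial _ K))
    (skewB_comp_perm (K := K) (a := a) (b := b) (c := c) (k := r + 1))
  have h₁ : Submodule.span K (minorsAB_C K a b c r) ≤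
      (Submodule.span K (symSkewSkew K a b c r)).comap L := by
    rw [Submodule.span_le]
    rintro f ⟨ρ, γ, rfl⟩
    refine Submodule.subset_span ⟨fun i => (ρ i).1, fun i => (ρ i).2, γ, ?_⟩
    rw [minor_AB_C_eq, Finset.sum_comm, map_sum]
    refine Finset.sum_congr rfl fun τ _ => ?_
    rw [map_zsmul, hL, Finset.smul_sum]
    refine Finset.sum_congr rfl fun σ _ => ?_
    rw [smul_smul, mul_comm]
  have h₂ : Submodule.span K (minorsAC_B K a b c r) ≤
      LinearMap.eqLocus L (((r + 1).factorial : K) • LinearMap.id) := by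
    rw [Submodule.span_le]
    rintro f ⟨ρ, β, rfl⟩
    change L _ = ((r + 1).factorial : K) • _
    have : ∀ τ : Equiv.Perm (Fin (r + 1)), L ((Equiv.Perm.sign τ : ℤ) •
        ∏ i, X ((ρ i).1, β (τ i), (ρ i).2)) = Matrix.det (Matrix.of fun i j =>
        (X ((ρ i).1, β j, (ρ i).2) : MvPolynomial (Fin a × Fin b × Fin c) K)) := by
      intro τ
      rw [map_zsmul, hL, Finset.smul_sum, minor_AC_B_eq]
      refine Fintype.sum_equiv (Equiv.mulLeft τ) _ _ fun σ => ?_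
      simp [mul_assoc]
    conv_lhs => rw [minor_AC_B_eq, map_sum]
    simp_rw [this]
    rw [Finset.sum_const, Finset.card_univ, Fintype.card_perm, Fintype.card_fin,
      Nat.cast_smul_eq_nsmul]
    rfl
  intro f ⟨hf₁, hf₂⟩
  have e : L f = ((r + 1).factorial : K) • f := h₂ hf₂
  have hr : ((r + 1).factorial : K) ≠ 0 := Nat.cast_ne_zero.2 (Nat.factorial_ne_zero _)
  have := Submodule.smul_mem _ ((r + 1).factorial : K)⁻¹
    (show L f ∈ Submodule.span K (symSkewSkew K a b c r) from h₁ hf₁)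
  rwa [e, smul_smul, inv_mul_cancel₀ hr, one_smul] at this

end Redundancy

section StandardMonomials

variable {b c : ℕ}

/-- Two variables in this relation form the diagonal of a `2 × 2` minor of one of the two
flattenings. -/
def DiagLT (p q : Fin 2 × Fin b × Fin c) : Prop :=
  p.1 = q.1 ∧ p.2.1 < q.2.1 ∧ p.2.2 < q.2.2 ∨ p.1 < q.1 ∧ (p.2.1 < q.2.1 ∨ p.2.2 < q.2.2)

/-- A weight for which the diagonal term of every minor of the two flattenings is the heaviest
one. -/
def diagWeight (p : Fin 2 × Fin b × Fin c) : ℕ :=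
  if p.1 = 0 then (b + c - p.2.1) * (b + c - p.2.2) else p.2.1 * p.2.2

/-- The exponent of the monomial `u_i v_j w_k` parametrizing the variable `x_{ijk}`. -/
noncomputable def multidegree {a : ℕ} (p : Fin a × Fin b × Fin c) : Fin a ⊕ Fin b ⊕ Fin c →₀ ℕ :=
  Finsupp.single (.inl p.1) 1 + Finsupp.single (.inr (.inl p.2.1)) 1 +
    Finsupp.single (.inr (.inr p.2.2)) 1

theorem diagLT_trans {p q s : Fin 2 × Fin b × Fin c} (h₁ : DiagLT p q) (h₂ : DiagLT q s) :
    DiagLT p s := by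
  unfold DiagLT at *
  rcases h₁ with ⟨_, _, _⟩ | ⟨_, _ | _⟩ <;> rcases h₂ with ⟨_, _, _⟩ | ⟨_, _ | _⟩ <;> omega

/-- The diagonal weight is a product once the indices are shifted by this amount. -/
def diagShift (b c : ℕ) (a : Fin 2) : ℤ := if a = 0 then (b : ℤ) + c else 0

theorem diagWeight_cast (p : Fin 2 × Fin b × Fin c) :
    (diagWeight p : ℤ) =
      ((p.2.1 : ℤ) - diagShift b c p.1) * ((p.2.2 : ℤ) - diagShift b c p.1) := by
  unfold diagWeight diagShift
  have h₁ := p.2.1.2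
  have h₂ := p.2.2.2
  split_ifs
  · push_cast [show (p.2.1 : ℕ) ≤ b + c by omega, show (p.2.2 : ℕ) ≤ b + c by omega]
    ring
  · simp

theorem exists_lighter_of_diagLT {p q : Fin 2 × Fin b × Fin c} (h : DiagLT p q) :
    ∃ p' q' : Fin 2 × Fin b × Fin c,
      multidegree p' + multidegree q' = multidegree p + multidegree q ∧
      diagWeight p' + diagWeight q' < diagWeight p + diagWeight q := by
  obtain ⟨i, j, k⟩ := p
  obtain ⟨i', j', k'⟩ := q
  have hk := k.2
  have hj := j.2
  rcases h with ⟨h₁, h₂, h₃⟩ | ⟨h₁, h₂ | h₂⟩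
  · dsimp only at h₁ h₂ h₃
    subst h₁
    refine ⟨(i, j, k'), (i, j', k), by simp only [multidegree]; abel, ?_⟩
    zify
    simp only [diagWeight_cast]
    have : (0 : ℤ) < ((j' : ℕ) - (j : ℕ)) * ((k' : ℕ) - (k : ℕ)) := by
      apply mul_pos <;> simp <;> omega
    linarith
  · obtain ⟨rfl, rfl⟩ : i = 0 ∧ i' = 1 := by dsimp only at h₁; omega
    refine ⟨(0, j', k), (1, j, k'), by simp only [multidegree]; abel, ?_⟩
    zify
    simp only [diagWeight_cast, diagShift]
    have : (0 : ℤ) < ((j' : ℕ) - (j : ℕ)) * (b + c + (k' : ℕ) - (k : ℕ)) := by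
      apply mul_pos
      · simp; omega
      · omega
    simp
    linarith
  · obtain ⟨rfl, rfl⟩ : i = 0 ∧ i' = 1 := by dsimp only at h₁; omega
    refine ⟨(0, j, k'), (1, j', k), by simp only [multidegree]; abel, ?_⟩
    zify
    simp only [diagWeight_cast, diagShift]
    have : (0 : ℤ) < ((k' : ℕ) - (k : ℕ)) * (b + c + (j' : ℕ) - (j : ℕ)) := by
      apply mul_pos
      · simp; omega
      · omega
    simp
    linarith

/-- The monomial is standard for the ideal of the Segre variety. -/
def IsDiagFree (m : Fin 2 × Fin b × Fin c →₀ ℕ) : Prop :=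
  ∀ p q, m p ≠ 0 → m q ≠ 0 → ¬DiagLT p q

theorem weight_weight {σ τ M : Type*} [AddCommMonoid M] (w : τ → M) (d : σ → τ →₀ ℕ)
    (n : σ →₀ ℕ) :
    Finsupp.weight w (Finsupp.weight d n) = Finsupp.weight (fun p => Finsupp.weight w (d p)) n := by
  rw [Finsupp.weight_apply d, Finsupp.sum, map_sum, Finsupp.weight_apply, Finsupp.sum]
  simp only [map_nsmul]

/-- The total multiplicity in `m` of the variables satisfying `S`. -/
def countOn {σ : Type*} [Fintype σ] (m : σ →₀ ℕ) (S : σ → Prop) [DecidablePred S] : ℕ :=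
  ∑ p, if S p then m p else 0

theorem countOn_eq_zero_or {σ : Type*} [Fintype σ] (m : σ →₀ ℕ) (S T : σ → Prop)
    [DecidablePred S] [DecidablePred T] (h : ∀ p q, m p ≠ 0 → m q ≠ 0 → S p → ¬T q) :
    countOn m S = 0 ∨ countOn m T = 0 := by
  by_contra! hne
  obtain ⟨p, -, hp⟩ := Finset.exists_ne_zero_of_sum_ne_zero hne.1
  obtain ⟨q, -, hq⟩ := Finset.exists_ne_zero_of_sum_ne_zero hne.2
  simp only [ne_eq, ite_eq_right_iff, not_forall] at hp hq
  exact h p q hp.2 hq.2 hp.1 hq.1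

theorem countOn_add {σ : Type*} [Fintype σ] (m : σ →₀ ℕ) (S T : σ → Prop)
    [DecidablePred S] [DecidablePred T] :
    countOn m (fun p => S p ∧ T p) + countOn m (fun p => S p ∧ ¬T p) = countOn m S := by
  unfold countOn
  rw [← Finset.sum_add_distrib]
  refine Finset.sum_congr rfl fun p _ => ?_
  by_cases h₁ : S p <;> by_cases h₂ : T p <;> simp [h₁, h₂]

theorem countOn_congr {σ : Type*} [Fintype σ] (m : σ →₀ ℕ) {S T : σ → Prop}
    [DecidablePred S] [DecidablePred T] (h : ∀ p, S p ↔ T p) : countOn m S = countOn m T := by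
  unfold countOn
  simp only [h]

theorem countOn_eq_weight {σ : Type*} [Fintype σ] (m : σ →₀ ℕ) (S : σ → Prop)
    [DecidablePred S] : countOn m S = Finsupp.weight (fun p => if S p then 1 else 0) m := by
  simp [countOn, Finsupp.weight_eq_sum]

theorem countOn_eq_of_multidegree {m n : Fin 2 × Fin b × Fin c →₀ ℕ}
    (h : Finsupp.weight multidegree m = Finsupp.weight multidegree n)
    (w : Fin 2 ⊕ Fin b ⊕ Fin c → ℕ) (S : Fin 2 × Fin b × Fin c → Prop) [DecidablePred S]
    (hS : ∀ p, (if S p then 1 else 0) = Finsupp.weight w (multidegree p)) :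
    countOn m S = countOn n S := by
  rw [countOn_eq_weight, countOn_eq_weight]
  simp only [hS, ← weight_weight, h]

/-- The number of variables of a standard monomial in a corner of a slice only depends on its
multidegree. -/
theorem countOn_corner_eq {m n : Fin 2 × Fin b × Fin c →₀ ℕ} (hm : IsDiagFree m)
    (hn : IsDiagFree n) (h : Finsupp.weight multidegree m = Finsupp.weight multidegree n)
    (i : Fin 2) (x y : ℕ) :
    countOn m (fun p => (p.1 = i ∧ p.2.1.1 < x) ∧ p.2.2.1 < y) =
      countOn n (fun p => (p.1 = i ∧ p.2.1.1 < x) ∧ p.2.2.1 < y) := by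
  have hi : ∀ i : Fin 2, countOn m (fun p => p.1 = i) = countOn n (fun p => p.1 = i) := fun i =>
    countOn_eq_of_multidegree h (Sum.elim (fun i' => if i' = i then 1 else 0) 0) _ fun p => by
      simp [multidegree, Finsupp.weight_single]
  have hx : countOn m (fun p => p.2.1.1 < x) = countOn n (fun p => p.2.1.1 < x) :=
    countOn_eq_of_multidegree h
      (Sum.elim 0 (Sum.elim (fun j => if j.1 < x then 1 else 0) 0)) _ fun p => by
      simp [multidegree, Finsupp.weight_single]
  have hy : countOn m (fun p => p.2.2.1 < y) = countOn n (fun p => p.2.2.1 < y) :=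
    countOn_eq_of_multidegree h
      (Sum.elim 0 (Sum.elim 0 fun k => if k.1 < y then 1 else 0)) _ fun p => by
      simp [multidegree, Finsupp.weight_single]
  have key : ∀ l : Fin 2 × Fin b × Fin c →₀ ℕ, IsDiagFree l →
      countOn l (fun p => (p.1 = i ∧ p.2.1.1 < x) ∧ p.2.2.1 < y) =
        (if i = 1 then min (countOn l fun p => p.2.1.1 < x) (countOn l fun p => p.1 = 1)
          else (countOn l fun p => p.2.1.1 < x) - countOn l fun p => p.1 = 1) +
        (if i = 1 then min (countOn l fun p => p.2.2.1 < y) (countOn l fun p => p.1 = 1)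
          else (countOn l fun p => p.2.2.1 < y) - countOn l fun p => p.1 = 1) -
        countOn l (fun p => p.1 = i) := by
    intro l hl
    have hi : ∀ p : Fin 2 × Fin b × Fin c, ¬p.1 = 1 ↔ p.1 = 0 := fun p => by omega
    have a₁ := countOn_eq_zero_or l (fun p => p.1 = 0 ∧ p.2.1.1 < x)
      (fun p => p.1 = 1 ∧ ¬p.2.1.1 < x) fun p q h₁ h₂ h₃ h₄ => hl p q h₁ h₂ <| by
        unfold DiagLT; omega
    have a₂ := countOn_eq_zero_or l (fun p => p.1 = 0 ∧ p.2.2.1 < y)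
      (fun p => p.1 = 1 ∧ ¬p.2.2.1 < y) fun p q h₁ h₂ h₃ h₄ => hl p q h₁ h₂ <| by
        unfold DiagLT; omega
    have a₃ := countOn_eq_zero_or l (fun p => (p.1 = i ∧ p.2.1.1 < x) ∧ p.2.2.1 < y)
      (fun p => (p.1 = i ∧ ¬p.2.1.1 < x) ∧ ¬p.2.2.1 < y) fun p q h₁ h₂ h₃ h₄ => hl p q h₁ h₂ <| by
        unfold DiagLT; omega
    have b₁ := countOn_add l (fun p => p.2.1.1 < x) (fun p => p.1 = 1)
    have b₂ := countOn_add l (fun p => p.2.2.1 < y) (fun p => p.1 = 1)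
    have b₃ := countOn_add l (fun p => p.1 = i) (fun p => p.2.1.1 < x)
    have b₄ := countOn_add l (fun p => p.1 = i) (fun p => p.2.2.1 < y)
    have b₅ := countOn_add l (fun p => p.1 = i ∧ p.2.1.1 < x) (fun p => p.2.2.1 < y)
    have b₆ := countOn_add l (fun p => p.1 = i ∧ ¬p.2.1.1 < x) (fun p => p.2.2.1 < y)
    have b₇ := countOn_add l (fun p => p.1 = i ∧ p.2.2.1 < y) (fun p => p.2.1.1 < x)
    have b₈ := countOn_add l (fun p => p.1 = 1) (fun p => p.2.1.1 < x)
    have b₉ := countOn_add l (fun p => p.1 = 1) (fun p => p.2.2.1 < y)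
    have c₁ : countOn l (fun p => p.2.1.1 < x ∧ p.1 = 1) =
      countOn l (fun p => p.1 = 1 ∧ p.2.1.1 < x) := countOn_congr l fun p => and_comm
    have c₂ : countOn l (fun p => p.2.2.1 < y ∧ p.1 = 1) =
      countOn l (fun p => p.1 = 1 ∧ p.2.2.1 < y) := countOn_congr l fun p => and_comm
    have c₃ : countOn l (fun p => p.2.1.1 < x ∧ ¬p.1 = 1) =
      countOn l (fun p => p.1 = 0 ∧ p.2.1.1 < x) := countOn_congr l fun p => by
        rw [hi, and_comm]
    have c₄ : countOn l (fun p => p.2.2.1 < y ∧ ¬p.1 = 1) =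
      countOn l (fun p => p.1 = 0 ∧ p.2.2.1 < y) := countOn_congr l fun p => by
        rw [hi, and_comm]
    have c₅ : countOn l (fun p => (p.1 = i ∧ p.2.2.1 < y) ∧ p.2.1.1 < x) =
      countOn l (fun p => (p.1 = i ∧ p.2.1.1 < x) ∧ p.2.2.1 < y) :=
        countOn_congr l fun p => and_right_comm
    have c₆ : countOn l (fun p => (p.1 = i ∧ p.2.2.1 < y) ∧ ¬p.2.1.1 < x) =
      countOn l (fun p => (p.1 = i ∧ ¬p.2.1.1 < x) ∧ p.2.2.1 < y) :=
        countOn_congr l fun p => and_right_comm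
    obtain rfl | rfl : i = 0 ∨ i = 1 := by omega
    · simp only [zero_ne_one, if_false]
      omega
    · simp only [if_true]
      omega
  rw [key m hm, key n hn, hi, hi, hx, hy]

theorem eq_of_isDiagFree {m n : Fin 2 × Fin b × Fin c →₀ ℕ} (hm : IsDiagFree m)
    (hn : IsDiagFree n) (h : Finsupp.weight multidegree m = Finsupp.weight multidegree n) :
    m = n := by
  ext ⟨i, j, k⟩
  have key : ∀ l : Fin 2 × Fin b × Fin c →₀ ℕ,
      countOn l (fun p => (p.1 = i ∧ p.2.1.1 < j + 1) ∧ p.2.2.1 < k + 1) +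
        countOn l (fun p => (p.1 = i ∧ p.2.1.1 < j) ∧ p.2.2.1 < k) =
      countOn l (fun p => (p.1 = i ∧ p.2.1.1 < j + 1) ∧ p.2.2.1 < k) +
        countOn l (fun p => (p.1 = i ∧ p.2.1.1 < j) ∧ p.2.2.1 < k + 1) + l (i, j, k) := by
    intro l
    have : l (i, j, k) = ∑ p, if p = (i, j, k) then l p else 0 := by simp
    rw [this]
    unfold countOn
    simp only [← Finset.sum_add_distrib]
    refine Finset.sum_congr rfl fun ⟨i', j', k'⟩ _ => ?_
    simp only [Prod.mk.injEq, Fin.ext_iff]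
    grind
  have h₁ := key m
  rw [countOn_corner_eq hm hn h, countOn_corner_eq hm hn h, countOn_corner_eq hm hn h,
    countOn_corner_eq hm hn h] at h₁
  have h₂ := key n
  omega

/-- A standard monomial is the unique lightest one of its multidegree. -/
theorem eq_or_weight_lt {m : Fin 2 × Fin b × Fin c →₀ ℕ} (hm : IsDiagFree m)
    (n : Fin 2 × Fin b × Fin c →₀ ℕ)
    (h : Finsupp.weight multidegree n = Finsupp.weight multidegree m) :
    n = m ∨ Finsupp.weight diagWeight m < Finsupp.weight diagWeight n := by
  induction hN : Finsupp.weight diagWeight n using Nat.strong_induction_on generalizing n with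
  | _ N ih =>
  by_cases hn : IsDiagFree n
  · exact .inl (eq_of_isDiagFree hn hm h)
  right
  unfold IsDiagFree at hn
  push Not at hn
  obtain ⟨p, q, hp, hq, hpq⟩ := hn
  obtain ⟨p', q', hd, hw⟩ := exists_lighter_of_diagLT hpq
  have hne : p ≠ q := by
    rintro rfl
    unfold DiagLT at hpq
    omega
  have hle : Finsupp.single p 1 + Finsupp.single q 1 ≤ n := by
    intro x
    simp only [Finsupp.add_apply, Finsupp.single_apply]
    grind
  obtain ⟨s, rfl⟩ := exists_add_of_le hle
  simp only [map_add, Finsupp.weight_single, one_smul] at h hN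
  have h₁ := ih (diagWeight p' + diagWeight q' + Finsupp.weight diagWeight s) (by omega)
    (Finsupp.single p' 1 + Finsupp.single q' 1 + s)
    (by simp only [map_add, Finsupp.weight_single, one_smul, hd, h])
    (by simp only [map_add, Finsupp.weight_single, one_smul])
  rcases h₁ with rfl | h₁
  · simp only [map_add, Finsupp.weight_single, one_smul]
    omega
  · omega

end StandardMonomials

section Chains

/-- Mirsky's theorem: a set without chains of length `r + 1` is the union of `r` antichains. -/
theorem exists_chain_or_exists_height {σ : Type*} (R : σ → σ → Prop) [IsTrans σ R] (r : ℕ)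
    (S : Set σ) :
    (∃ p : Fin (r + 1) → σ, (∀ i, p i ∈ S) ∧ ∀ i j, i < j → R (p i) (p j)) ∨
      ∃ h : σ → ℕ, (∀ p ∈ S, h p < r) ∧ ∀ p ∈ S, ∀ q ∈ S, R p q → h p < h q := by
  classical
  induction r generalizing S with
  | zero =>
    rcases S.eq_empty_or_nonempty with rfl | ⟨p, hp⟩
    · exact .inr ⟨fun _ => 0, by simp, by simp⟩
    · exact .inl ⟨fun _ => p, fun _ => hp, fun i j hij => by omega⟩
  | succ r ih =>
    rcases ih {q ∈ S | ∃ p ∈ S, R p q} with ⟨p, hp, hR⟩ | ⟨h, hr, hR⟩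
    · obtain ⟨q, hq, hqp⟩ := (hp 0).2
      refine .inl ⟨Fin.cons q p, fun i => ?_, fun i j hij => ?_⟩
      · cases i using Fin.cases with
        | zero => exact hq
        | succ i => exact (hp i).1
      · cases j using Fin.cases with
        | zero => simp at hij
        | succ j =>
          cases i using Fin.cases with
          | zero =>
            rcases eq_or_ne j 0 with rfl | hj
            · exact hqp
            · exact _root_.trans hqp (hR 0 j (Fin.pos_iff_ne_zero.2 hj))
          | succ i => exact hR i j (Fin.succ_lt_succ_iff.1 hij)
    · refine .inr ⟨fun q => if ∃ p ∈ S, R p q then h q + 1 else 0, fun q hq => ?_,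
        fun p hp q hq hpq => ?_⟩
      · dsimp only
        split_ifs with hq'
        · have := hr q ⟨hq, hq'⟩
          omega
        · omega
      · dsimp only
        rw [if_pos (⟨p, hp, hpq⟩ : ∃ p ∈ S, R p q)]
        split_ifs with hp'
        · have := hR p ⟨hp, hp'⟩ q ⟨hq, p, hp, hpq⟩ hpq
          omega
        · omega

end Chains

section Straightening

variable {b c : ℕ}

instance : IsTrans (Fin 2 × Fin b × Fin c) DiagLT := ⟨fun _ _ _ => diagLT_trans⟩

theorem sum_mul_comp_perm_lt {k : ℕ} {s t : Fin k → ℤ} (hs : StrictMono s) (ht : StrictMono t)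
    {τ : Equiv.Perm (Fin k)} (hτ : τ ≠ 1) : ∑ i, s i * t (τ i) < ∑ i, s i * t i := by
  refine (hs.monotone.monovary ht.monotone).sum_mul_comp_perm_lt_sum_mul_iff.2 fun hm => hτ ?_
  have hmono : StrictMono τ := by
    refine Monotone.strictMono_of_injective (fun i j hij => ?_) τ.injective
    by_contra! hlt
    have := hs.le_iff_le.1 (hm (show t (τ j) < t (τ i) from ht hlt))
    rw [le_antisymm hij this] at hlt
    exact lt_irrefl _ hlt
  have := (hmono.range_inj strictMono_id).1 (by simp)
  exact Equiv.ext fun i => congrFun this i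

theorem sum_diagWeight_permC_lt {k : ℕ} {p : Fin k → Fin 2 × Fin b × Fin c}
    (hs : StrictMono fun i => ((p i).2.1 : ℤ) - diagShift b c (p i).1)
    (ht : StrictMono fun i => (p i).2.2) {τ : Equiv.Perm (Fin k)} (hτ : τ ≠ 1) :
    ∑ i, diagWeight ((p i).1, (p i).2.1, (p (τ i)).2.2) < ∑ i, diagWeight (p i) := by
  zify
  simp only [diagWeight_cast, mul_sub, Finset.sum_sub_distrib]
  have ht' : StrictMono fun i => (((p i).2.2 : ℕ) : ℤ) := fun i j hij => by
    exact Int.ofNat_lt.2 (ht hij)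
  exact sub_lt_sub_right (sum_mul_comp_perm_lt hs ht' hτ) _

theorem sum_diagWeight_permB_lt {k : ℕ} {p : Fin k → Fin 2 × Fin b × Fin c}
    (hs : StrictMono fun i => ((p i).2.2 : ℤ) - diagShift b c (p i).1)
    (ht : StrictMono fun i => (p i).2.1) {τ : Equiv.Perm (Fin k)} (hτ : τ ≠ 1) :
    ∑ i, diagWeight ((p i).1, (p (τ i)).2.1, (p i).2.2) < ∑ i, diagWeight (p i) := by
  zify
  simp only [diagWeight_cast]
  simp only [mul_comm _ (((Prod.snd (Prod.snd _) : Fin c) : ℤ) - _), mul_sub,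
    Finset.sum_sub_distrib]
  have ht' : StrictMono fun i => (((p i).2.1 : ℕ) : ℤ) := fun i j hij => by
    exact Int.ofNat_lt.2 (ht hij)
  exact sub_lt_sub_right (sum_mul_comp_perm_lt hs ht' hτ) _

theorem strictMono_or_strictMono {k : ℕ} {p : Fin k → Fin 2 × Fin b × Fin c}
    (hp : ∀ i j, i < j → DiagLT (p i) (p j)) :
    (StrictMono fun i => (p i).2.2) ∨ StrictMono fun i => (p i).2.1 := by
  by_contra! h
  unfold StrictMono at h
  push Not at h
  obtain ⟨⟨i, j, hij, h₁⟩, i', j', hij', h₂⟩ := h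
  have e₁ := hp i j hij
  have e₂ := hp i' j' hij'
  have e₃ := hp i j'
  have e₄ := hp i' j
  have e₅ := hp i i'
  have e₆ := hp i' i
  have e₇ := hp j j'
  have e₈ := hp j' j
  unfold DiagLT at *
  rcases lt_trichotomy i i' with hi | rfl | hi <;>
    rcases lt_trichotomy j j' with hj | rfl | hj <;> grind

theorem strictMono_sub_diagShift {k N : ℕ} {p : Fin k → Fin 2 × Fin b × Fin c}
    (hp : ∀ i j, i < j → DiagLT (p i) (p j)) (f : Fin 2 × Fin b × Fin c → Fin N)
    (hN : N ≤ b + c) (hf : ∀ q q', DiagLT q q' → q.1 = q'.1 → f q < f q') :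
    StrictMono fun i => (f (p i) : ℤ) - diagShift b c (p i).1 := by
  intro i j hij
  have h := hp i j hij
  by_cases he : (p i).1 = (p j).1
  · have := hf _ _ h he
    simp only [he]
    omega
  · have hlt : (p i).1 < (p j).1 := by
      unfold DiagLT at h
      tauto
    obtain ⟨h₀, h₁⟩ : (p i).1 = 0 ∧ (p j).1 = 1 := by omega
    have := (f (p i)).2
    simp [diagShift, h₀, h₁]
    omega

variable {K : Type} [Field K]

/-- Modulo an alternating sum whose term at the identity divides it and is the heaviest one, a
monomial is a combination of lighter ones. -/
theorem monomial_mem_of_alternating_sum_mem {σ : Type*} {k : ℕ}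
    {J : Ideal (MvPolynomial σ K)} (w : σ → ℕ) (q : Equiv.Perm (Fin k) → Fin k → σ)
    (hq : ∀ τ, τ ≠ 1 → ∑ i, w (q τ i) < ∑ i, w (q 1 i))
    (hJ : ∑ τ : Equiv.Perm (Fin k), (Equiv.Perm.sign τ : ℤ) • ∏ i, X (q τ i) ∈ J)
    (N : Submodule K (MvPolynomial σ K)) (hJN : J.restrictScalars K ≤ N) (s : σ →₀ ℕ)
    (hN : ∀ n, Finsupp.weight w n < Finsupp.weight w (∑ i, Finsupp.single (q 1 i) 1 + s) →
      monomial n 1 ∈ N) :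
    monomial (∑ i, Finsupp.single (q 1 i) 1 + s) 1 ∈ N := by
  have key : ∀ τ, monomial s (1 : K) * ∏ i, X (q τ i) =
      monomial (∑ i, Finsupp.single (q τ i) 1 + s) 1 := fun τ => by
    rw [show ∏ i, (X (q τ i) : MvPolynomial σ K) = monomial (∑ i, Finsupp.single (q τ i) 1) 1 by
      rw [monomial_sum_one]; rfl, monomial_mul, add_comm, one_mul]
  have h : monomial s (1 : K) *
      ∑ τ : Equiv.Perm (Fin k), (Equiv.Perm.sign τ : ℤ) • ∏ i, X (q τ i) ∈ N :=
    hJN (J.mul_mem_left _ hJ)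
  rw [Finset.mul_sum, ← Finset.add_sum_erase _ _ (Finset.mem_univ 1)] at h
  simp only [mul_smul_comm, key, Equiv.Perm.sign_one, Units.val_one, one_smul] at h
  refine (N.add_mem_iff_left (Submodule.sum_mem _ fun τ hτ => zsmul_mem (hN _ ?_) _)).1 h
  simp only [map_add, map_sum, Finsupp.weight_single, one_smul]
  exact Nat.add_lt_add_right (hq τ (Finset.ne_of_mem_erase hτ)) _

/-- The monomial is standard for the ideal of the secant variety. -/
def IsChainFree (r : ℕ) (m : Fin 2 × Fin b × Fin c →₀ ℕ) : Prop :=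
  ¬∃ p : Fin (r + 1) → Fin 2 × Fin b × Fin c,
    (∀ i, p i ∈ {x | m x ≠ 0}) ∧ ∀ i j, i < j → DiagLT (p i) (p j)

theorem monomial_mem_span_minors_sup (r : ℕ) (m : Fin 2 × Fin b × Fin c →₀ ℕ) :
    monomial m (1 : K) ∈
      (Ideal.span (minorsAB_C K 2 b c r ∪ minorsAC_B K 2 b c r)).restrictScalars K ⊔
        Submodule.span K ((fun n => monomial n 1) '' {n | IsChainFree r n}) := by
  induction hN : Finsupp.weight diagWeight m using Nat.strong_induction_on generalizing m with
  | _ N ih =>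
  subst hN
  by_cases hm : IsChainFree r m
  · exact Submodule.mem_sup_right (Submodule.subset_span ⟨m, hm, rfl⟩)
  obtain ⟨p, hpm, hp⟩ := not_not.1 hm
  have hinj : Function.Injective p := by
    have hne : ∀ i j, i < j → p i ≠ p j := fun i j hij he => by
      have := hp i j hij
      rw [he] at this
      unfold DiagLT at this
      omega
    intro i j he
    rcases lt_trichotomy i j with h | h | h
    exacts [(hne i j h he).elim, h, (hne j i h he.symm).elim]
  have hle : ∑ i, Finsupp.single (p i) 1 ≤ m := by
    intro x
    rw [Finsupp.finsetSum_apply]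
    by_cases hx : ∃ i, p i = x
    · obtain ⟨i, rfl⟩ := hx
      simp only [Finsupp.single_apply, hinj.eq_iff, Finset.sum_ite_eq', Finset.mem_univ, if_true]
      exact Nat.one_le_iff_ne_zero.2 (hpm i)
    · push Not at hx
      simp [hx]
  obtain ⟨s, rfl⟩ := exists_add_of_le hle
  rcases strictMono_or_strictMono hp with ht | ht
  · refine monomial_mem_of_alternating_sum_mem diagWeight
      (fun τ i => ((p i).1, (p i).2.1, (p (τ i)).2.2)) (fun τ hτ => ?_) ?_ _ le_sup_left s
      fun n hn => ih _ hn n rfl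
    · refine sum_diagWeight_permC_lt (strictMono_sub_diagShift hp (fun q => q.2.1)
        (Nat.le_add_right b c) fun q q' h he => ?_) ht hτ
      unfold DiagLT at h
      omega
    · rw [← minor_AB_C_eq (fun i => ((p i).1, (p i).2.1)) fun i => (p i).2.2]
      exact Ideal.subset_span (.inl ⟨_, _, rfl⟩)
  · refine monomial_mem_of_alternating_sum_mem diagWeight
      (fun τ i => ((p i).1, (p (τ i)).2.1, (p i).2.2)) (fun τ hτ => ?_) ?_ _ le_sup_left s
      fun n hn => ih _ hn n rfl
    · refine sum_diagWeight_permB_lt (strictMono_sub_diagShift hp (fun q => q.2.2)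
        (Nat.le_add_left c b) fun q q' h he => ?_) ht hτ
      unfold DiagLT at h
      omega
    · rw [← minor_AC_B_eq (fun i => ((p i).1, (p i).2.2)) fun i => (p i).2.1]
      exact Ideal.subset_span (.inr ⟨_, _, rfl⟩)

end Straightening

section Secant

theorem det_mul_eq_zero {K : Type*} [Field K] {r : ℕ} (A : Matrix (Fin (r + 1)) (Fin r) K)
    (B : Matrix (Fin r) (Fin (r + 1)) K) : (A * B).det = 0 := by
  by_contra h
  have h₁ := Matrix.rank_of_isUnit _ ((Matrix.isUnit_iff_isUnit_det _).2 (isUnit_iff_ne_zero.2 h))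
  have h₂ := (Matrix.rank_mul_le_left A B).trans A.rank_le_card_width
  simp only [Fintype.card_fin] at h₁ h₂
  omega

variable {K : Type} [Field K]

theorem minors_subset_secantIdeal (a b c r : ℕ) :
    minorsAB_C K a b c r ∪ minorsAC_B K a b c r ⊆ secantIdeal K a b c r := by
  intro f hf
  simp only [secantIdeal, SetLike.mem_coe, Submodule.mem_iInf]
  rintro T ⟨u, v, w, hT⟩
  rw [RingHom.mem_ker]
  rcases hf with ⟨ρ, γ, rfl⟩ | ⟨ρ, β, rfl⟩
  · rw [RingHom.map_det]
    convert det_mul_eq_zero (Matrix.of fun i l => u l (ρ i).1 * v l (ρ i).2)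
      (Matrix.of fun l j => w l (γ j))
    ext i j
    simp [Matrix.mul_apply, hT]
  · rw [RingHom.map_det]
    convert det_mul_eq_zero (Matrix.of fun i l => u l (ρ i).1 * w l (ρ i).2)
      (Matrix.of fun l j => v l (β j))
    ext i j
    simp [Matrix.mul_apply, hT, mul_right_comm]

theorem aeval_monomial_apply {σ τ : Type*} (d : σ → τ →₀ ℕ) (n : σ →₀ ℕ) (x : K) :
    aeval (fun i => monomial (d i) (1 : K)) (monomial n x) =
      monomial (Finsupp.weight d n) x := by
  rw [aeval_monomial, Finsupp.prod]
  simp only [monomial_pow, one_pow]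
  rw [← monomial_sum_one, algebraMap_eq, C_mul_monomial, mul_one]
  rfl

theorem coeff_aeval_monomial {σ τ : Type*} (d : σ → τ →₀ ℕ) (g : MvPolynomial σ K)
    (n₀ : σ →₀ ℕ)
    (h : ∀ n ∈ g.support, Finsupp.weight d n = Finsupp.weight d n₀ → n = n₀) :
    coeff (Finsupp.weight d n₀) (aeval (fun i => monomial (d i) (1 : K)) g) = coeff n₀ g := by
  classical
  conv_lhs => rw [g.as_sum, map_sum, coeff_sum]
  simp only [aeval_monomial_apply, coeff_monomial]
  rw [Finset.sum_eq_single n₀]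
  · simp
  · intro n hn hne
    rw [if_neg fun he => hne (h n hn he)]
  · intro hn
    simpa using hn

/-- The generic sum of `r` points of affine space. -/
noncomputable def genericSum (K : Type) [Field K] (σ : Type*) (r : ℕ) :
    MvPolynomial σ K →ₐ[K] MvPolynomial (Fin r × σ) K :=
  aeval fun p => ∑ l, X (l, p)

theorem coeff_genericSum_ne_zero {σ : Type*} {r : ℕ} {f : MvPolynomial σ K}
    {n : Fin r × σ →₀ ℕ} (h : coeff n (genericSum K σ r f) ≠ 0) :
    coeff (Finsupp.weight (fun x => Finsupp.single x.2 1) n) f ≠ 0 := by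
  rw [f.as_sum, map_sum, coeff_sum] at h
  obtain ⟨m, hm, hne⟩ := Finset.exists_ne_zero_of_sum_ne_zero h
  have hom : IsWeightedHomogeneous (fun x : Fin r × σ => Finsupp.single x.2 1)
      (genericSum K σ r (monomial m (coeff m f))) m := by
    rw [genericSum, aeval_monomial, algebraMap_eq]
    refine IsWeightedHomogeneous.C_mul ?_ _
    have := IsWeightedHomogeneous.prod m.support
      (fun p => (∑ l : Fin r, (X (l, p) : MvPolynomial (Fin r × σ) K)) ^ m p)
      (fun p => m p • Finsupp.single p 1)
      (w := fun x : Fin r × σ => (Finsupp.single x.2 1 : σ →₀ ℕ)) fun p _ =>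
        (IsWeightedHomogeneous.sum _ _ _ fun l _ => isWeightedHomogeneous_X K _ (l, p)).pow _
    have hm' : ∑ p ∈ m.support, m p • Finsupp.single p 1 = m := by
      conv_rhs => rw [← m.sum_single]
      simp [Finsupp.sum]
    rwa [hm'] at this
  rw [hom hne]
  exact mem_support_iff.1 hm

theorem coeff_mapDomain_genericSum {σ : Type*} {r : ℕ} (f : MvPolynomial σ K) (h : σ → Fin r)
    (m : σ →₀ ℕ) :
    coeff (m.mapDomain fun p => (h p, p)) (genericSum K σ r f) = coeff m f := by
  classical
  have hinj : Function.Injective fun p => (h p, p) := fun p q hpq => (Prod.ext_iff.1 hpq).2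
  rw [← coeff_killCompl hinj]
  have : (killCompl hinj).comp (genericSum K σ r) = AlgHom.id K _ := by
    refine algHom_ext fun p => ?_
    simp only [genericSum, AlgHom.comp_apply, aeval_X, map_sum, AlgHom.id_apply]
    rw [Finset.sum_eq_single (h p)]
    · have := killCompl_rename_app hinj (X p : MvPolynomial σ K)
      rwa [rename_X] at this
    · intro l _ hl
      rw [X, killCompl_monomial_eq_zero_of_notMem_range hinj _ (a := (l, p))]
      · simp
      · rintro ⟨q, hq⟩
        simp only [Prod.mk.injEq] at hq
        exact hl (by rw [← hq.1, hq.2])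
    · simp
  rw [← AlgHom.comp_apply, this, AlgHom.id_apply]

/-- The exponent of the monomial parametrizing a variable of the `l`-th decomposable summand. -/
noncomputable def summandDegree {a b c r : ℕ} (x : Fin r × Fin a × Fin b × Fin c) :
    Fin r × (Fin a ⊕ Fin b ⊕ Fin c) →₀ ℕ :=
  Finsupp.single (x.1, .inl x.2.1) 1 + Finsupp.single (x.1, .inr (.inl x.2.2.1)) 1 +
    Finsupp.single (x.1, .inr (.inr x.2.2.2)) 1

theorem aeval_genericSum_eq_zero [Infinite K] {a b c r : ℕ}
    {f : MvPolynomial (Fin a × Fin b × Fin c) K} (hf : f ∈ secantIdeal K a b c r) :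
    aeval (fun x => monomial (summandDegree x) (1 : K)) (genericSum K _ r f) = 0 := by
  refine MvPolynomial.funext fun t => ?_
  simp only [secantIdeal, Submodule.mem_iInf] at hf
  have h := hf (fun x => ∑ l, t (l, .inl x.1) * t (l, .inr (.inl x.2.1)) *
    t (l, .inr (.inr x.2.2))) ⟨fun l i => t (l, .inl i),
    fun l j => t (l, .inr (.inl j)), fun l k => t (l, .inr (.inr k)), fun x => rfl⟩
  rw [RingHom.mem_ker] at h
  rw [map_zero, ← h, ← coe_aeval_eq_eval, ← coe_aeval_eq_eval]
  simp only [RingHom.coe_coe]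
  rw [← AlgHom.comp_apply, ← AlgHom.comp_apply]
  congr 1
  refine algHom_ext fun p => ?_
  simp [genericSum, summandDegree, monomial_add_single, eval_monomial]

theorem weight_multidegree_curry {a b c r : ℕ} (n : Fin r × Fin a × Fin b × Fin c →₀ ℕ)
    (l : Fin r) :
    Finsupp.weight multidegree (n.curry l) =
      Finsupp.weight (fun y : Fin r × (Fin a ⊕ Fin b ⊕ Fin c) =>
        if y.1 = l then Finsupp.single y.2 1 else 0) (Finsupp.weight summandDegree n) := by
  rw [weight_weight, Finsupp.weight_eq_sum _ n, Fintype.sum_prod_type, Finset.sum_eq_single l]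
  · simp [Finsupp.weight_eq_sum _ (n.curry l), summandDegree, multidegree, Finsupp.weight_single]
  · intro l' _ hl'
    simp [summandDegree, Finsupp.weight_single, hl']
  · simp

theorem weight_weight_snd {σ : Type*} [Fintype σ] {r : ℕ} (w : σ → ℕ) (n : Fin r × σ →₀ ℕ) :
    Finsupp.weight w (Finsupp.weight (fun x => Finsupp.single x.2 1) n) =
      ∑ l, Finsupp.weight w (n.curry l) := by
  rw [weight_weight]
  simp only [Finsupp.weight_single, one_smul]
  simp only [Finsupp.weight_eq_sum, Fintype.sum_prod_type, Finsupp.curry_apply]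

/-- Standard monomials are linearly independent on the secant variety. -/
theorem eq_zero_of_mem_secantIdeal [Infinite K] {b c r : ℕ} (hpos : 1 ≤ r)
    {f : MvPolynomial (Fin 2 × Fin b × Fin c) K} (hf : f ∈ secantIdeal K 2 b c r)
    (hs : ∀ m ∈ f.support, IsChainFree r m) : f = 0 := by
  classical
  by_contra hne
  obtain ⟨m, hm, hmax⟩ := f.support.exists_max_image (Finsupp.weight diagWeight)
    (support_nonempty.2 hne)
  obtain ⟨h, hr, hh⟩ := (exists_chain_or_exists_height DiagLT r {x | m x ≠ 0}).resolve_left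
    (hs m hm)
  let g : Fin 2 × Fin b × Fin c → Fin r := fun p => if hp : h p < r then ⟨h p, hp⟩ else ⟨0, hpos⟩
  have hg : ∀ p, m p ≠ 0 → (g p : ℕ) = h p := fun p hp => by simp [g, hr p hp]
  have hinj : Function.Injective fun p => (g p, p) := fun p q hpq => (Prod.ext_iff.1 hpq).2
  set n₀ := m.mapDomain fun p => (g p, p) with hn₀
  have hcurry : ∀ l p, n₀.curry l p = if g p = l then m p else 0 := by
    intro l p
    rw [Finsupp.curry_apply]
    split_ifs with hl
    · rw [← hl]
      exact Finsupp.mapDomain_apply hinj m p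
    · refine Finsupp.mapDomain_of_notMem_range _ _ ?_
      rintro ⟨q, hq⟩
      simp only [Prod.mk.injEq] at hq
      exact hl (by rw [← hq.1, hq.2])
  have hfree : ∀ l, IsDiagFree (n₀.curry l) := by
    intro l p q hp hq hpq
    simp only [hcurry, ne_eq, ite_eq_right_iff, not_forall] at hp hq
    obtain ⟨hpl, hp⟩ := hp
    obtain ⟨hql, hq⟩ := hq
    have := hh p hp q hq hpq
    rw [← hg p hp, ← hg q hq, hpl, hql] at this
    exact lt_irrefl _ this
  have hsnd : Finsupp.weight (fun x : Fin r × _ => Finsupp.single x.2 1) n₀ = m := by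
    rw [hn₀, Finsupp.weight_apply, Finsupp.sum_mapDomain_index_inj hinj]
    simp
  have hcoeff := coeff_aeval_monomial summandDegree (genericSum K _ r f) n₀ fun n hn hw => by
    have hle := hmax _ (mem_support_iff.2 (coeff_genericSum_ne_zero (mem_support_iff.1 hn)))
    rw [← congrArg (Finsupp.weight diagWeight) hsnd, weight_weight_snd, weight_weight_snd] at hle
    have hor := fun l => eq_or_weight_lt (hfree l) (n.curry l) <| by
      rw [weight_multidegree_curry, weight_multidegree_curry, hw]
    have heq : ∀ l, n.curry l = n₀.curry l := by
      by_contra! ⟨l, hl⟩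
      refine hle.not_gt (Finset.sum_lt_sum (fun l _ => ?_)
        ⟨l, Finset.mem_univ l, (hor l).resolve_left hl⟩)
      rcases hor l with hl | hl
      · rw [hl]
      · exact hl.le
    ext ⟨l, p⟩
    rw [← Finsupp.curry_apply, heq, Finsupp.curry_apply]
  rw [aeval_genericSum_eq_zero hf, coeff_zero, coeff_mapDomain_genericSum] at hcoeff
  exact mem_support_iff.1 hm hcoeff.symm

end Secant

/-- **Theorem 1 (Landsberg–Weyman).**  For `dim A = 2` and any `b, c`, the ideal of
`σ_r(PA* × PB* × PC*)` is generated in degree `r+1` by the two flattening modules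
`Λ^{r+1}(A⊗B) ⊗ Λ^{r+1}C` and `Λ^{r+1}(A⊗C) ⊗ Λ^{r+1}B`, i.e. by the `(r+1)×(r+1)`
minors of the flattenings `(A⊗B)⊗C` and `(A⊗C)⊗B`; the redundancy in this description
(the intersection of the two spaces of minors inside `S^{r+1}(A⊗B⊗C)`) is the
irreducible module `S^{r+1}A ⊗ Λ^{r+1}B ⊗ Λ^{r+1}C`. -/
theorem sigma_r_P1_ideal (K : Type) [Field K] [CharZero K] (b c r : ℕ) (hr : 1 ≤ r) :
    secantIdeal K 2 b c r = Ideal.span (minorsAB_C K 2 b c r ∪ minorsAC_B K 2 b c r) ∧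
    Submodule.span K (minorsAB_C K 2 b c r) ⊓ Submodule.span K (minorsAC_B K 2 b c r) =
      Submodule.span K (symSkewSkew K 2 b c r) := by
  refine ⟨le_antisymm (fun f hf => ?_) (Ideal.span_le.2 (minors_subset_secantIdeal 2 b c r)),
    span_minors_inf_span_minors⟩
  have htop : f ∈ (Ideal.span (minorsAB_C K 2 b c r ∪ minorsAC_B K 2 b c r)).restrictScalars K ⊔
        Submodule.span K ((fun n => monomial n 1) '' {n | IsChainFree r n}) := by
    rw [f.as_sum]
    refine Submodule.sum_mem _ fun m _ => ?_
    rw [← mul_one (coeff m f), ← smul_eq_mul, ← smul_monomial]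
    exact Submodule.smul_mem _ _ (monomial_mem_span_minors_sup r m)
  obtain ⟨g, hg, s, hs, rfl⟩ := Submodule.mem_sup.1 htop
  have hs0 : s = 0 := by
    refine eq_zero_of_mem_secantIdeal hr ?_ ?_
    · exact (Ideal.add_mem_iff_right _
        (Ideal.span_le.2 (minors_subset_secantIdeal 2 b c r) hg)).1 hf
    · intro m hm
      by_contra hfree
      refine mem_support_iff.1 hm ?_
      have hle : Submodule.span K ((fun n => monomial n 1) '' {n | IsChainFree r n}) ≤
          LinearMap.ker (lcoeff K m) := by
        rw [Submodule.span_le]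
        rintro _ ⟨n, hn, rfl⟩
        classical
        simp only [SetLike.mem_coe, LinearMap.mem_ker, lcoeff_apply, coeff_monomial]
        exact if_neg fun he : n = m => hfree (he ▸ hn)
      exact hle hs
  rw [hs0, add_zero]
  exact hg
end

section
/- Let K be a field of characteristic zero, A_1,...,A_n finite-dimensional K-vector spaces with dim A_j = a_j, and let b_j ≤ a_j be nonnegative integers, reordered so that b_1 ≤ b_2 ≤ ... ≤ b_n. The ideal of Sub_{b_1,...,b_n} is generated in degrees b_j + 1 (1 ≤ j ≤ n) by the irreducible modules occurring in Λ^{b_j+1}A_j ⊗ Λ^{b_j+1}(A_1⊗...⊗A_{j-1}⊗A_{j+1}⊗...⊗A_n) ⊂ S^{b_j+1}(A_1⊗...⊗A_n) (the (b_j+1)×(b_j+1) minors of the j-th one-versus-rest flattening), namely by those irreducible modules S_{π_1}A_1⊗...⊗S_{π_n}A_n therein such that for i ≤ j one has l(π_i) ≤ b_i, unless b_i = b_j, in which case l(π_i) = b_i + 1 is also allowed. In particular, if all b_i = r, the ideal of Sub_{r,...,r} is generated in degree r+1 by the irreducible modules appearing in Λ^{r+1}A_j ⊗ Λ^{r+1}(A_1⊗...⊗A_{j-1}⊗A_{j+1}⊗...⊗A_n)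 for 1 ≤ j ≤ n (minus redundancies). -/
/-!
Statement 7: generators of the ideal of the subspace variety `Sub_{b₁,...,b_n}`
(with `b₁ ≤ b₂ ≤ ... ≤ b_n`).  The ideal is generated in degrees `b_j + 1` by the
irreducible modules occurring among the `(b_j+1)×(b_j+1)` minors of the `j`-th
one-versus-the-rest flattening whose partitions `π_i` for `i ≤ j` satisfy
`l(π_i) ≤ b_i`, unless `b_i = b_j`, in which case `l(π_i) = b_i + 1` is also allowed.
The part of the span of the minors consisting of the irreducible modules with
`l(π_i) ≤ c_i` is exactly the intersection of the span of the minors with the span of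
the pullbacks of polynomials from a tensor product of spaces of dimensions `c_i`.
In particular, if all `b_i = r`, the ideal of `Sub_{r,...,r}` is generated in degree
`r+1` by the `(r+1)×(r+1)` minors of all one-versus-the-rest flattenings.
-/

open MvPolynomial

variable {n : ℕ}

/-- Index set of the natural basis of `A₁ ⊗ ... ⊗ A_n`, `dim A_j = a j`. -/
abbrev Ind (a : Fin n → ℕ) := ∀ j, Fin (a j)

/-- The subspace variety `Sub_{b₁,...,b_n} ⊆ A₁* ⊗ ... ⊗ A_n*`: tensors `T` lying in
`A₁'* ⊗ ... ⊗ A_n'*` for some subspaces `A_j'` with `dim A_j' = b j`. -/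
def subspaceVariety (K : Type) [Field K] (a b : Fin n → ℕ) : Set (Ind a → K) :=
  { T | ∃ A' : ∀ j, Submodule K (Fin (a j) → K),
      (∀ j, Module.finrank K (A' j) = b j) ∧
      ∀ (j : Fin n) (w : Ind a), (fun i => T (Function.update w j i)) ∈ A' j }

/-- The ideal of the subspace variety: all polynomials vanishing on it. -/
noncomputable def subIdeal (K : Type) [Field K] (a b : Fin n → ℕ) :
    Ideal (MvPolynomial (Ind a) K) :=
  ⨅ (T : Ind a → K) (_ : T ∈ subspaceVariety K a b), RingHom.ker (MvPolynomial.eval T)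

/-- The `m×m` minors of the `j₀`-th one-factor-versus-the-rest flattening
`A_{j₀}* ⊗ (A₁⊗...⊗Â_{j₀}⊗...⊗A_n)*`; they span the module
`Λ^m A_{j₀} ⊗ Λ^m (A₁⊗...⊗Â_{j₀}⊗...⊗A_n) ⊂ S^m (A₁⊗...⊗A_n)`. -/
noncomputable def oneVsRestMinors (K : Type) [Field K] (a : Fin n → ℕ) (j₀ : Fin n)
    (m : ℕ) : Set (MvPolynomial (Ind a) K) :=
  { f | ∃ (ρ : Fin m → Fin (a j₀)) (γ : Fin m → Ind a),
      f = Matrix.det (Matrix.of fun i j : Fin m =>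
        (X (Function.update (γ j) j₀ (ρ i)) : MvPolynomial (Ind a) K)) }

/-- Pullback of polynomials along the tensor product of linear maps
`A_j* → K^{c_j}*`.  The span of the images of all such pullbacks is the sum of all the
irreducible modules `S_{π₁}A₁ ⊗ ... ⊗ S_{π_n}A_n` with `l(π_j) ≤ c j` for all `j`. -/
noncomputable def pullbackSpan (K : Type) [Field K] (a c : Fin n → ℕ) :
    Submodule K (MvPolynomial (Ind a) K) :=
  Submodule.span K
    { f | ∃ (α : ∀ j, Fin (c j) → Fin (a j) → K) (g : MvPolynomial (Ind c) K),
        f = MvPolynomial.aeval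
          (fun v : Ind c => ∑ w : Ind a,
            (∏ j, α j (v j) (w j)) • (X w : MvPolynomial (Ind a) K)) g }

/-- The length bounds `c_i` of Theorem 3.1 for the `j`-th flattening:
for `i < j`, `c_i = b_i` unless `b_i = b_j` where also `b_i + 1` is allowed;
`c_j = b_j + 1`; no condition for `i > j`. -/
def lengthBound (a b : Fin n → ℕ) (j : Fin n) : Fin n → ℕ :=
  fun i => if i < j then (if b i < b j then b i else b i + 1)
    else if i = j then b j + 1 else a i

section

open Equiv Finset

section

variable {D ι : Type*}

/-- The action of tuples of permutations on tuples of words, by permuting letters. -/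
def wordAct {A : ι → Type*} (w : ∀ j, D → A j) (g : ι → Perm D) : ∀ j, D → A j :=
  fun j => w j ∘ g j

theorem wordAct_mul {A : ι → Type*} (w : ∀ j, D → A j) (g h : ι → Perm D) :
    wordAct w (g * h) = wordAct (wordAct w g) h := rfl

theorem wordAct_one {A : ι → Type*} (w : ∀ j, D → A j) : wordAct w 1 = w := rfl

/-- `wordAct` as a permutation of the set of tuples of words. -/
def wordEquiv {A : ι → Type*} (g : ι → Perm D) : (∀ j, D → A j) ≃ (∀ j, D → A j) where
  toFun w := wordAct w g
  invFun w := wordAct w g⁻¹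
  left_inv w := by
    change wordAct w (g * g⁻¹) = w
    rw [mul_inv_cancel, wordAct_one]
  right_inv w := by
    change wordAct w (g⁻¹ * g) = w
    rw [inv_mul_cancel, wordAct_one]

variable [DecidableEq ι]

/-- The permutation `τ` acting on the factor `j` alone. -/
def factorPerm (j : ι) (τ : Perm D) : ι → Perm D := Pi.mulSingle j τ

theorem factorPerm_same (j : ι) (τ : Perm D) : factorPerm j τ j = τ := by simp [factorPerm]

theorem factorPerm_of_ne {i j : ι} (h : i ≠ j) (τ : Perm D) : factorPerm j τ i = 1 := by
  simp [factorPerm, h]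

theorem factorPerm_one (j : ι) : factorPerm j (1 : Perm D) = 1 := by simp [factorPerm]

theorem factorPerm_mul (j : ι) (τ τ' : Perm D) :
    factorPerm j (τ * τ') = factorPerm j τ * factorPerm j τ' :=
  Pi.mulSingle_mul (f := fun _ : ι => Perm D) j τ τ'

theorem factorPerm_inv (j : ι) (τ : Perm D) :
    factorPerm j τ⁻¹ = (factorPerm j τ)⁻¹ :=
  Pi.mulSingle_inv (f := fun _ : ι => Perm D) j τ

end

variable {D : Type*} [Fintype D] [DecidableEq D]

/-- The permutations fixing every point outside `S`. -/
def permsOn (S : Finset D) : Finset (Perm D) := univ.filter fun τ => ∀ k, k ∉ S → τ k = k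

theorem mem_permsOn {S : Finset D} {τ : Perm D} : τ ∈ permsOn S ↔ ∀ k, k ∉ S → τ k = k := by
  simp [permsOn]

theorem permsOn_singleton (p : D) : permsOn ({p} : Finset D) = {1} := by
  ext τ
  simp only [mem_permsOn, mem_singleton]
  constructor
  · intro h
    ext k
    by_cases hk : k = p
    · subst hk
      by_contra hne
      exact hne (by simpa using τ.injective (h _ hne))
    · simp [h k hk]
  · rintro rfl k _
    rfl

theorem sum_permsOn_insert {E : Type*} [AddCommGroup E] {S : Finset D} {p : D} (hp : p ∉ S)
    (F : Perm D → E) :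
    ∑ τ ∈ permsOn (insert p S), (Perm.sign τ : ℤ) • F τ =
      ∑ τ ∈ permsOn S, (Perm.sign τ : ℤ) • (F τ - ∑ q ∈ S, F (τ * swap p q)) := by
  have key : ∑ τ ∈ permsOn (insert p S), (Perm.sign τ : ℤ) • F τ =
      ∑ x ∈ permsOn S ×ˢ insert p S,
        (Perm.sign (x.1 * swap p x.2) : ℤ) • F (x.1 * swap p x.2) := by
    symm
    refine Finset.sum_bij' (fun x _ => x.1 * swap p x.2)
      (fun τ _ => (τ * swap p (τ.symm p), τ.symm p)) ?_ ?_ ?_ ?_ ?_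
    · rintro ⟨τ, q⟩ h
      simp only [mem_product, mem_permsOn, mem_insert, not_or] at h ⊢
      rintro k ⟨hk, hkS⟩
      have hkq : k ≠ q := by
        rintro rfl
        rcases h.2 with h2 | h2
        · exact hk h2
        · exact hkS h2
      simp [swap_apply_of_ne_of_ne hk hkq, h.1 k hkS]
    · intro τ h
      simp only [mem_product, mem_permsOn, mem_insert, not_or] at h ⊢
      constructor
      · intro k hk
        by_cases hkp : k = p
        · subst hkp; simp
        · have h1 := h k ⟨hkp, hk⟩
          have h2 : k ≠ τ.symm p := by
            rintro rfl
            rw [apply_symm_apply] at h1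
            exact hkp h1.symm
          simp [swap_apply_of_ne_of_ne hkp h2, h1]
      · by_contra hc
        have h1 := h (τ.symm p) (by simpa [not_or] using hc)
        rw [apply_symm_apply] at h1
        exact hc (Or.inl h1.symm)
    · rintro ⟨τ, q⟩ h
      simp only [mem_product, mem_permsOn] at h
      have h1 : τ.symm p = p := by rw [symm_apply_eq, h.1 p hp]
      have h2 : (τ * swap p q).symm p = q := by simp [symm_apply_eq, h.1 p hp]
      simp [h2, mul_assoc]
    · intro τ h
      simp [mul_assoc]
    · intro x _
      rfl
  rw [key, Finset.sum_product]
  refine Finset.sum_congr rfl fun τ _ => ?_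
  rw [Finset.sum_insert hp, smul_sub, Finset.smul_sum, sub_eq_add_neg, ← Finset.sum_neg_distrib]
  congr 1
  · rw [swap_self, ← Perm.one_def, mul_one]
  · refine Finset.sum_congr rfl fun q hq => ?_
    have : p ≠ q := by rintro rfl; exact hp hq
    simp [Perm.sign_swap this]

variable {ι : Type*} [Fintype ι] [DecidableEq ι]

/-- The Young subgroup preserving the colouring `κ j` in each factor `j`. -/
def youngStab {C : ι → Type*} [∀ j, DecidableEq (C j)] (κ : ∀ j, D → C j) :
    Finset (ι → Perm D) :=
  univ.filter fun σ => ∀ j k, κ j (σ j k) = κ j k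

theorem mem_youngStab {C : ι → Type*} [∀ j, DecidableEq (C j)] {κ : ∀ j, D → C j}
    {σ : ι → Perm D} : σ ∈ youngStab κ ↔ ∀ j k, κ j (σ j k) = κ j k := by
  simp [youngStab]

/-- Functions on a power of the symmetric group which are annihilated, on all two-sided
translates, by the symmetrizers of the `b`-bounded Young subgroups and by the antisymmetrizers
of `b j + 1` points in the `j`-th factor. -/
structure IsAnnihilated {E : Type*} [AddCommGroup E] (b : ι → ℕ) (Φ : (ι → Perm D) → E) :
    Prop where
  young : ∀ κ : ι → D → ℕ, (∀ j k, κ j k < b j) → ∀ g h, ∑ σ ∈ youngStab κ, Φ (g * σ * h) = 0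
  anti : ∀ (j : ι) (S : Finset D), S.card = b j + 1 → ∀ g h,
    ∑ τ ∈ permsOn S, (Perm.sign τ : ℤ) • Φ (g * factorPerm j τ * h) = 0

section

variable {E : Type*} [AddCommGroup E]

theorem IsAnnihilated.translate {b : ι → ℕ} {Φ : (ι → Perm D) → E} (hΦ : IsAnnihilated b Φ)
    (h : ι → Perm D) : IsAnnihilated b fun g => Φ (g * h) where
  young κ hκ g h' := by simpa [mul_assoc] using hΦ.young κ hκ g (h' * h)
  anti j S hS g h' := by simpa [mul_assoc] using hΦ.anti j S hS g (h' * h)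

theorem IsAnnihilated.sum {b : ι → ℕ} {α : Type*} (s : Finset α) {Φ : α → (ι → Perm D) → E}
    (hΦ : ∀ i ∈ s, IsAnnihilated b (Φ i)) : IsAnnihilated b fun g => ∑ i ∈ s, Φ i g where
  young κ hκ g h := by
    rw [Finset.sum_comm]
    exact Finset.sum_eq_zero fun i hi => (hΦ i hi).young κ hκ g h
  anti j S hS g h := by
    simp_rw [Finset.smul_sum]
    rw [Finset.sum_comm]
    exact Finset.sum_eq_zero fun i hi => (hΦ i hi).anti j S hS g h

theorem sum_swap_youngInvariant {Φ : (ι → Perm D) → E} {κ : ι → D → ℕ}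
    (hinv : ∀ σ ∈ youngStab κ, ∀ g, Φ (g * σ) = Φ g) {j : ι} {p : D} {c : ℕ}
    (hc : c < κ j p) :
    ∀ σ ∈ youngStab (Function.update κ j (Function.update (κ j) p c)), ∀ g,
      ∑ q ∈ insert p (univ.filter fun q => κ j q = c), Φ (g * σ * factorPerm j (swap p q)) =
        ∑ q ∈ insert p (univ.filter fun q => κ j q = c), Φ (g * factorPerm j (swap p q)) := by
  intro σ hσ g
  rw [mem_youngStab] at hσ
  set B := insert p (univ.filter fun q => κ j q = c) with hB
  set κ' := Function.update (κ j) p c with hκ'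
  have hBmem : ∀ q, q ∈ B ↔ κ' q = c := by
    intro q
    by_cases hq : q = p
    · subst hq; simp [hB, hκ']
    · simp [hB, hκ', hq]
  have hσj : ∀ k, κ' (σ j k) = κ' k := by simpa using hσ j
  have hσi : ∀ i, i ≠ j → ∀ k, κ i (σ i k) = κ i k := fun i hi => by simpa [hi] using hσ i
  refine Finset.sum_bij' (fun q _ => σ j q) (fun q _ => (σ j).symm q) ?_ ?_ ?_ ?_ ?_
  · intro q hq
    rw [hBmem] at hq ⊢
    rw [hσj, hq]
  · intro q hq
    rw [hBmem] at hq ⊢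
    rw [← hσj, apply_symm_apply, hq]
  · simp
  · simp
  · intro q hq
    set ρ := factorPerm j (swap p (σ j q)) * σ * factorPerm j (swap p q) with hρ
    have hsw : ∀ q, q ∈ B → ∀ k, κ' (swap p q k) = κ' k := by
      intro q hq k
      rw [hBmem] at hq
      have hp : κ' p = c := by simp [hκ']
      rcases eq_or_ne k p with rfl | hkp
      · rw [swap_apply_left, hq, hp]
      rcases eq_or_ne k q with rfl | hkq
      · rw [swap_apply_right, hq, hp]
      · rw [swap_apply_of_ne_of_ne hkp hkq]
    have hσq : σ j q ∈ B := by
      rw [hBmem] at hq ⊢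
      rw [hσj, hq]
    have hρstab : ρ ∈ youngStab κ := by
      rw [mem_youngStab]
      intro i k
      by_cases hi : i = j
      · subst hi
        have hρi : ρ i = swap p (σ i q) * σ i * swap p q := by
          simp [hρ, factorPerm_same]
        have hρp : ρ i p = p := by simp [hρi]
        by_cases hk : k = p
        · rw [hk, hρp]
        · have hne : ρ i k ≠ p := fun h => hk ((ρ i).injective (h.trans hρp.symm))
          have h1 : κ' (ρ i k) = κ' k := by
            rw [hρi, Perm.mul_apply, Perm.mul_apply, hsw _ hσq, hσj, hsw _ hq]
          simpa [hκ', hne, hk] using h1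
      · simp [hρ, factorPerm_of_ne hi, hσi i hi]
    have h2 : g * σ * factorPerm j (swap p q) = g * factorPerm j (swap p (σ j q)) * ρ := by
      have : factorPerm j (swap p (σ j q)) * factorPerm j (swap p (σ j q)) = 1 := by
        rw [← factorPerm_mul, swap_mul_self, factorPerm_one]
      rw [hρ, mul_assoc g (factorPerm _ _), ← mul_assoc (factorPerm _ _) (_ * σ),
        ← mul_assoc (factorPerm _ _) (factorPerm _ _) σ, this, one_mul, mul_assoc]
    rw [h2, hinv ρ hρstab]

variable [IsAddTorsionFree E]

theorem IsAnnihilated.antisymm_eq_zero {b : ι → ℕ} {Φ : (ι → Perm D) → E}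
    (hΦ : IsAnnihilated b Φ) {κ : ι → D → ℕ} {j : ι}
    (hswap : ∀ p, ∀ c < κ j p, ∀ g,
      ∑ q ∈ univ.filter (fun q => κ j q = c), Φ (g * factorPerm j (swap p q)) = -Φ g)
    (m : ℕ) (hm : m ≤ b j) (S : Finset D) (hS : ∀ p ∈ S, m ≤ κ j p)
    (hcard : S.card = b j + 1 - m) (g : ι → Perm D) :
    ∑ τ ∈ permsOn S, (Perm.sign τ : ℤ) • Φ (g * factorPerm j τ) = 0 := by
  induction m generalizing S with
  | zero => simpa using hΦ.anti j S (by simpa using hcard) g 1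
  | succ m ih =>
    set B := univ.filter fun q => κ j q = m with hB
    have hpos : B.card + S.card ≠ 0 := by omega
    have hdisj : ∀ q ∈ B, q ∉ S := by
      intro q hq hqS
      have h1 := hS q hqS
      simp only [hB, mem_filter, mem_univ, true_and] at hq
      omega
    have hzero : ∑ q ∈ B, ∑ τ ∈ permsOn (insert q S),
        (Perm.sign τ : ℤ) • Φ (g * factorPerm j τ) = 0 := by
      refine Finset.sum_eq_zero fun q hq => ih (by omega) _ ?_ ?_
      · intro p hp
        rcases mem_insert.mp hp with rfl | hp
        · simp only [hB, mem_filter, mem_univ, true_and] at hq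
          exact hq.ge
        · exact (Nat.le_succ m).trans (hS p hp)
      · rw [card_insert_of_notMem (hdisj q hq), hcard]
        omega
    refine (nsmul_eq_zero_iff_right hpos).mp ?_
    rw [← hzero]
    have hexp : ∀ q ∈ B, ∑ τ ∈ permsOn (insert q S),
        (Perm.sign τ : ℤ) • Φ (g * factorPerm j τ) = ∑ τ ∈ permsOn S, (Perm.sign τ : ℤ) •
          (Φ (g * factorPerm j τ) - ∑ s ∈ S, Φ (g * factorPerm j τ * factorPerm j (swap s q))) := by
      intro q hq
      rw [sum_permsOn_insert (hdisj q hq)]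
      refine Finset.sum_congr rfl fun τ _ => ?_
      congr 2
      refine Finset.sum_congr rfl fun s _ => ?_
      rw [factorPerm_mul, mul_assoc, swap_comm]
    rw [Finset.sum_congr rfl hexp, Finset.sum_comm, Finset.smul_sum]
    refine Finset.sum_congr rfl fun τ _ => ?_
    rw [← Finset.smul_sum, smul_comm]
    congr 1
    rw [Finset.sum_sub_distrib, Finset.sum_comm (s := B)]
    have : ∀ s ∈ S, ∑ q ∈ B, Φ (g * factorPerm j τ * factorPerm j (swap s q)) =
        -Φ (g * factorPerm j τ) := fun s hs => hswap s m (hS s hs) _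
    rw [Finset.sum_congr rfl this]
    simp [add_smul]

theorem IsAnnihilated.eq_zero_of_youngInvariant {b : ι → ℕ} (N : ℕ) :
    ∀ (κ : ι → D → ℕ), ∑ j, ∑ k, κ j k = N → ∀ (Φ : (ι → Perm D) → E), IsAnnihilated b Φ →
      (∀ σ ∈ youngStab κ, ∀ g, Φ (g * σ) = Φ g) → ∀ g, Φ g = 0 := by
  induction N using Nat.strong_induction_on with
  | _ N ih =>
    intro κ hκ Φ hΦ hinv g
    by_cases hb : ∀ j k, κ j k < b j
    · have h1 := hΦ.young κ hb g 1
      simp only [mul_one] at h1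
      rw [Finset.sum_congr rfl fun σ hσ => hinv σ hσ g, Finset.sum_const] at h1
      refine (nsmul_eq_zero_iff_right (Finset.card_ne_zero_of_mem (a := 1) ?_)).mp h1
      simp [mem_youngStab]
    · push Not at hb
      obtain ⟨j, p, hjp⟩ := hb
      have hswap : ∀ p, ∀ c < κ j p, ∀ g,
          ∑ q ∈ univ.filter (fun q => κ j q = c), Φ (g * factorPerm j (swap p q)) = -Φ g := by
        intro p c hc g
        have hp : p ∉ univ.filter fun q => κ j q = c := by simp [hc.ne']
        have hlt : ∑ i, ∑ k, Function.update κ j (Function.update (κ j) p c) i k < N := by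
          rw [← hκ]
          have hle : ∀ k, Function.update (κ j) p c k ≤ κ j k := by
            intro k
            rcases eq_or_ne k p with rfl | hk
            · simpa using hc.le
            · simp [hk]
          refine Finset.sum_lt_sum (fun i _ => ?_) ⟨j, mem_univ j, ?_⟩
          · rcases eq_or_ne i j with rfl | hi
            · simpa using Finset.sum_le_sum fun k _ => hle k
            · simp [hi]
          · rw [Function.update_self]
            exact Finset.sum_lt_sum (fun k _ => hle k) ⟨p, mem_univ p, by simpa using hc⟩
        have h0 := ih _ hlt _ rfl
          (fun g => ∑ q ∈ insert p (univ.filter fun q => κ j q = c),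
            Φ (g * factorPerm j (swap p q)))
          (IsAnnihilated.sum _ fun q _ => hΦ.translate _) (sum_swap_youngInvariant hinv hc) g
        simp only [Finset.sum_insert hp] at h0
        rw [swap_self, ← Perm.one_def, factorPerm_one, mul_one] at h0
        exact eq_neg_of_add_eq_zero_right h0
      have := hΦ.antisymm_eq_zero hswap (b j) le_rfl {p} (by simpa using hjp)
        (by simp) g
      simpa [permsOn_singleton, factorPerm_one] using this

theorem IsAnnihilated.eq_zero {b : ι → ℕ} {Φ : (ι → Perm D) → E} (hΦ : IsAnnihilated b Φ)
    (g : ι → Perm D) : Φ g = 0 := by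
  refine IsAnnihilated.eq_zero_of_youngInvariant _
    (fun _ k => (Fintype.equivFin D k : ℕ)) rfl Φ hΦ (fun σ hσ g => ?_) g
  have : σ = 1 := by
    ext j k
    have := mem_youngStab.mp hσ j k
    simpa [Fin.val_inj] using this
  rw [this, mul_one]

end

/-- Ryser's inclusion-exclusion formula for the permanent. -/
theorem Matrix.permanent_eq_sum_powerset {R : Type*} [CommRing R] (Z : Matrix D D R) :
    Z.permanent = ∑ T : Finset D, (-1) ^ T.card * ∏ k, ∑ k' ∈ Tᶜ, Z k' k := by
  have h1 : ∀ T : Finset D, (-1 : R) ^ T.card * ∏ k, ∑ k' ∈ Tᶜ, Z k' k =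
      ∑ g : D → D, (if T ⊆ (univ.image g)ᶜ then (-1) ^ T.card else 0) * ∏ k, Z (g k) k := by
    intro T
    rw [Finset.prod_univ_sum, Finset.mul_sum]
    simp_rw [ite_mul, zero_mul]
    rw [← Finset.sum_filter]
    refine Finset.sum_congr ?_ fun _ _ => rfl
    ext g
    simp only [Fintype.mem_piFinset, mem_compl, mem_filter, mem_univ, true_and]
    constructor
    · intro h k hk
      simp only [mem_compl, mem_image, mem_univ, true_and, not_exists]
      rintro l rfl
      exact h l hk
    · intro h l hl
      have := h hl
      simp at this
  have h2 : ∀ g : D → D, ∑ T : Finset D,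
      (if T ⊆ (univ.image g)ᶜ then (-1 : R) ^ T.card else 0) =
        if Function.Bijective g then 1 else 0 := by
    intro g
    rw [← Finset.sum_filter]
    have h3 : univ.filter (fun T : Finset D => T ⊆ (univ.image g)ᶜ) =
        ((univ.image g)ᶜ).powerset := by
      ext T; simp
    rw [h3]
    have h4 := Finset.sum_powerset_neg_one_pow_card (x := (univ.image g)ᶜ)
    have h5 : (∑ T ∈ ((univ.image g)ᶜ).powerset, (-1 : R) ^ T.card) =
        ((∑ T ∈ ((univ.image g)ᶜ).powerset, (-1 : ℤ) ^ T.card : ℤ) : R) := by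
      push_cast; rfl
    rw [h5, h4]
    have h6 : (univ.image g)ᶜ = ∅ ↔ Function.Bijective g := by
      rw [← Finite.surjective_iff_bijective, compl_eq_empty_iff]
      simp [Finset.eq_univ_iff_forall, Function.Surjective]
    simp [h6]
  simp_rw [h1]
  rw [Finset.sum_comm]
  simp_rw [← Finset.sum_mul, h2, ite_mul, one_mul, zero_mul]
  rw [← Finset.sum_filter, Matrix.permanent]
  refine Finset.sum_bij (fun σ _ => σ) ?_ ?_ ?_ ?_
  · intro σ _
    simp
  · intro σ _ τ _ h
    exact Equiv.coe_fn_injective h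
  · intro g hg
    exact ⟨Equiv.ofBijective g (by simpa using hg), mem_univ _, rfl⟩
  · intro σ _
    rfl

theorem sum_wordAct {A : ι → Type*} [∀ j, Fintype (A j)] {V : Type*} [AddCommMonoid V]
    (F : (∀ j, D → A j) → V) (g : ι → Perm D) : ∑ w, F (wordAct w g) = ∑ w, F w :=
  Equiv.sum_comp (wordEquiv g) F

theorem sum_youngStab_mem_of_forall_weight {K : Type*} [Field K] {V : Type*} [AddCommGroup V]
    [Module K V] (N : Submodule K V) {A C : ι → Type*} [∀ j, Fintype (A j)]
    [∀ j, DecidableEq (A j)] [∀ j, DecidableEq (C j)] (κ : ∀ j, D → C j)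
    (F : (∀ j, D → A j) → V)
    (h : ∀ α : ∀ j, C j → A j → K, ∑ w, (∏ j, ∏ k, α j (κ j k) (w j k)) • F w ∈ N)
    (u : ∀ j, D → A j) : ∑ σ ∈ youngStab κ, F (wordAct u σ) ∈ N := by
  let Z : ∀ w : (∀ j, D → A j), ∀ j, Matrix D D K := fun w j =>
    Matrix.of fun k' k => if κ j k' = κ j k ∧ u j k' = w j k then 1 else 0
  let α : (ι → Finset D) → ∀ j, C j → A j → K := fun T j c e =>
    ∑ k' ∈ (T j)ᶜ, if κ j k' = c ∧ u j k' = e then 1 else 0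
  have h1 : ∑ T : ι → Finset D, (∏ j, (-1 : K) ^ (T j).card) •
      ∑ w, (∏ j, ∏ k, α T j (κ j k) (w j k)) • F w = ∑ w, (∏ j, (Z w j).permanent) • F w := by
    simp_rw [Finset.smul_sum, smul_smul]
    rw [Finset.sum_comm]
    refine Finset.sum_congr rfl fun w _ => ?_
    rw [← Finset.sum_smul]
    congr 1
    simp_rw [Matrix.permanent_eq_sum_powerset]
    rw [Finset.prod_univ_sum, Fintype.piFinset_univ]
    refine Finset.sum_congr rfl fun T _ => ?_
    rw [← Finset.prod_mul_distrib]
    rfl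
  have h2 : ∀ w, ∏ j, (Z w j).permanent =
      ∑ σ ∈ youngStab κ, if wordAct u σ = w then (1 : K) else 0 := by
    intro w
    simp_rw [Matrix.permanent]
    rw [Finset.prod_univ_sum, Fintype.piFinset_univ, youngStab, Finset.sum_filter]
    refine Finset.sum_congr rfl fun σ _ => ?_
    simp only [Z, Matrix.of_apply, Finset.prod_ite_zero, Finset.prod_const_one, mem_univ,
      forall_const]
    rw [← ite_and]
    congr 1
    simp only [funext_iff, wordAct, Function.comp_apply, forall_and]
  have h3 : ∑ σ ∈ youngStab κ, F (wordAct u σ) = ∑ w, (∏ j, (Z w j).permanent) • F w := by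
    simp_rw [h2, Finset.sum_smul]
    rw [Finset.sum_comm]
    simp
  rw [h3, ← h1]
  exact N.sum_mem fun T _ => N.smul_mem _ (h _)

section

variable {K : Type} [Field K] {d : ℕ} {a : Fin n → ℕ}

/-- The monomial whose `k`-th variable is indexed by the `k`-th letters of the words `w j`. -/
noncomputable def wordMonomial (K : Type) [Field K] {d : ℕ} {a : Fin n → ℕ}
    (w : ∀ j, Fin d → Fin (a j)) : MvPolynomial (Ind a) K :=
  ∏ k, X (fun j => w j k)

theorem wordMonomial_diag (w : ∀ j, Fin d → Fin (a j)) (τ : Perm (Fin d)) :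
    wordMonomial K (wordAct w fun _ => τ) = wordMonomial K w :=
  Equiv.prod_comp τ fun k => (X (fun j => w j k) : MvPolynomial (Ind a) K)

theorem sum_words_eq_prod {R : Type*} [CommRing R] (F : Fin d → Ind a → R) :
    ∑ w : (∀ j, Fin d → Fin (a j)), ∏ k, F k (fun j => w j k) = ∏ k, ∑ v, F k v := by
  rw [Finset.prod_univ_sum, Fintype.piFinset_univ]
  exact Equiv.sum_comp (Equiv.piComm fun (j : Fin n) (_ : Fin d) => Fin (a j))
    fun p => ∏ k, F k (p k)

theorem sum_youngStab_wordMonomial_mem {c : Fin n → ℕ} (κ : ∀ j, Fin d → Fin (c j))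
    (u : ∀ j, Fin d → Fin (a j)) :
    ∑ σ ∈ youngStab κ, wordMonomial K (wordAct u σ) ∈ pullbackSpan K a c := by
  refine sum_youngStab_mem_of_forall_weight _ κ (wordMonomial K) (fun α => ?_) u
  refine Submodule.subset_span ⟨α, ∏ k, X (fun j => κ j k), ?_⟩
  rw [map_prod]
  simp_rw [aeval_X]
  rw [← sum_words_eq_prod]
  refine Finset.sum_congr rfl fun w _ => ?_
  rw [wordMonomial, Finset.prod_comm, Finset.prod_smul]

theorem det_minor_eq_sum {T : Type*} [Fintype T] [DecidableEq T] (w : ∀ j, T → Fin (a j))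
    (j : Fin n) :
    (Matrix.of fun k' k : T => (X (Function.update (fun i => w i k) j (w j k')) :
      MvPolynomial (Ind a) K)).det =
    ∑ τ : Perm T, (Perm.sign τ : ℤ) • ∏ k, X (fun i => wordAct w (factorPerm j τ) i k) := by
  rw [Matrix.det_apply]
  refine Finset.sum_congr rfl fun τ _ => ?_
  rw [Units.smul_def]
  congr 1
  refine Finset.prod_congr rfl fun k _ => ?_
  rw [Matrix.of_apply]
  congr 1
  funext i
  by_cases hi : i = j
  · subst hi; simp [wordAct, factorPerm_same]
  · simp [wordAct, factorPerm_of_ne hi, hi]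

theorem det_minor_mem_oneVsRestMinors {T : Type*} [Fintype T] [DecidableEq T]
    (w : ∀ j, T → Fin (a j)) (j : Fin n) :
    (Matrix.of fun k' k : T => (X (Function.update (fun i => w i k) j (w j k')) :
      MvPolynomial (Ind a) K)).det ∈ oneVsRestMinors K a j (Fintype.card T) := by
  let e := (Fintype.equivFin T).symm
  refine ⟨fun k => w j (e k), fun k i => w i (e k), ?_⟩
  rw [← Matrix.det_submatrix_equiv_self e]
  rfl

theorem sum_perm_wordMonomial_mem {m : ℕ} (w : ∀ j, Fin m → Fin (a j)) (j : Fin n) :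
    ∑ τ : Perm (Fin m), (Perm.sign τ : ℤ) • wordMonomial K (wordAct w (factorPerm j τ)) ∈
      oneVsRestMinors K a j m := by
  have := det_minor_mem_oneVsRestMinors (K := K) w j
  rwa [det_minor_eq_sum, Fintype.card_fin] at this

theorem exists_sum_perm_wordMonomial {m : ℕ} {j : Fin n} {f : MvPolynomial (Ind a) K}
    (hf : f ∈ oneVsRestMinors K a j m) : ∃ w : ∀ j, Fin m → Fin (a j),
      f = ∑ τ : Perm (Fin m), (Perm.sign τ : ℤ) • wordMonomial K (wordAct w (factorPerm j τ)) := by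
  obtain ⟨ρ, γ, rfl⟩ := hf
  refine ⟨fun i k => Function.update (γ k) j (ρ k) i, ?_⟩
  refine Eq.trans ?_ (det_minor_eq_sum _ j)
  congr 2
  ext1 k'
  ext1 k
  simp

theorem sum_permsOn_eq {V : Type*} [AddCommMonoid V] {D : Type*} [Fintype D] [DecidableEq D]
    (S : Finset D) (F : Perm D → V) :
    ∑ τ ∈ permsOn S, F τ = ∑ τ : Perm S, F (Perm.ofSubtype τ) := by
  symm
  refine Finset.sum_bij (fun τ _ => Perm.ofSubtype τ) ?_ ?_ ?_ ?_
  · intro τ _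
    rw [mem_permsOn]
    exact fun k hk => Perm.ofSubtype_apply_of_not_mem τ hk
  · intro τ _ τ' _ h
    exact Perm.ofSubtype_injective h
  · intro τ hτ
    rw [mem_permsOn] at hτ
    have h2 : ∀ k, τ k ≠ k → k ∈ S := fun k hk => by
      by_contra h
      exact hk (hτ k h)
    have h1 : ∀ k, τ k ∈ S ↔ k ∈ S := by
      intro k
      by_cases hk : τ k = k
      · rw [hk]
      · exact ⟨fun _ => h2 k hk, fun _ => h2 _ fun h => hk (τ.injective h)⟩
    exact ⟨τ.subtypePerm h1, mem_univ _, Perm.ofSubtype_subtypePerm h1 h2⟩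
  · intro τ _
    rfl

theorem sum_permsOn_wordMonomial_mem (u : ∀ j, Fin d → Fin (a j)) (j : Fin n)
    (S : Finset (Fin d)) :
    ∑ τ ∈ permsOn S, (Perm.sign τ : ℤ) • wordMonomial K (wordAct u (factorPerm j τ)) ∈
      Ideal.span (oneVsRestMinors K a j S.card) := by
  have h1 : ∑ τ ∈ permsOn S, (Perm.sign τ : ℤ) • wordMonomial K (wordAct u (factorPerm j τ)) =
      (∏ k ∈ Sᶜ, X fun i => u i k) * (Matrix.of fun k' k : S =>
        (X (Function.update (fun i => u i k) j (u j k')) : MvPolynomial (Ind a) K)).det := by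
    rw [det_minor_eq_sum (fun i (k : S) => u i k), sum_permsOn_eq, Finset.mul_sum]
    refine Finset.sum_congr rfl fun τ _ => ?_
    rw [Perm.sign_ofSubtype, mul_smul_comm]
    congr 1
    rw [wordMonomial, ← Finset.prod_compl_mul_prod S]
    congr 1
    · refine Finset.prod_congr rfl fun k hk => ?_
      rw [mem_compl] at hk
      congr 1
      funext i
      by_cases hi : i = j
      · subst hi
        simp [wordAct, factorPerm_same, Perm.ofSubtype_apply_of_not_mem τ hk]
      · simp [wordAct, factorPerm_of_ne hi]
    · rw [← Finset.prod_coe_sort]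
      refine Finset.prod_congr rfl fun k _ => ?_
      congr 1
      funext i
      by_cases hi : i = j
      · subst hi
        simp [wordAct, factorPerm_same, Perm.ofSubtype_apply_coe]
      · simp [wordAct, factorPerm_of_ne hi]
  rw [h1]
  refine Ideal.mul_mem_left _ _ (Ideal.subset_span ?_)
  have := det_minor_mem_oneVsRestMinors (K := K) (fun i (k : S) => u i k) j
  rwa [Fintype.card_coe] at this

theorem wordMonomial_factorPerm_mul (u : ∀ j, Fin d → Fin (a j)) (j : Fin n)
    (τ : Perm (Fin d)) (g : Fin n → Perm (Fin d)) :
    wordMonomial K (wordAct u (factorPerm j τ * g)) =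
      wordMonomial K (wordAct (wordAct u (g * fun _ => (g j)⁻¹)) (factorPerm j τ)) := by
  rw [← wordMonomial_diag _ (g j)⁻¹, ← wordAct_mul, ← wordAct_mul]
  congr 2
  funext i
  by_cases hi : i = j
  · subst hi; simp [factorPerm_same, mul_assoc]
  · simp [factorPerm_of_ne hi]

theorem sum_permsOn_wordMonomial_mul_mem (u : ∀ j, Fin d → Fin (a j)) (j : Fin n)
    (S : Finset (Fin d)) (g h : Fin n → Perm (Fin d)) :
    ∑ τ ∈ permsOn S, (Perm.sign τ : ℤ) • wordMonomial K (wordAct u (g * factorPerm j τ * h)) ∈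
      Ideal.span (oneVsRestMinors K a j S.card) := by
  simp_rw [mul_assoc g, wordAct_mul u g, wordMonomial_factorPerm_mul]
  exact sum_permsOn_wordMonomial_mem _ _ _

theorem Submodule.exists_le_finrank_eq {V : Type*} [AddCommGroup V] [Module K V]
    [FiniteDimensional K V] (p : Submodule K V) {m : ℕ} (hp : Module.finrank K p ≤ m)
    (hm : m ≤ Module.finrank K V) : ∃ q, p ≤ q ∧ Module.finrank K q = m := by
  induction m, hp using Nat.le_induction with
  | base => exact ⟨p, le_rfl, rfl⟩
  | succ m _ ih =>
    obtain ⟨q, hpq, hq⟩ := ih (by omega)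
    obtain ⟨v, hv⟩ : ∃ v, v ∉ q := by
      by_contra! h
      have : q = ⊤ := by ext; simp [h]
      rw [this, finrank_top] at hq
      omega
    refine ⟨q ⊔ K ∙ v, hpq.trans le_sup_left, ?_⟩
    have hv0 : v ≠ 0 := fun h => hv (h ▸ q.zero_mem)
    have h1 := Submodule.finrank_sup_add_finrank_inf_eq q (K ∙ v)
    have h2 : q ⊓ K ∙ v = ⊥ := by
      rw [← disjoint_iff]
      exact (Submodule.disjoint_span_singleton' hv0).mpr hv
    rw [h2, finrank_bot, finrank_span_singleton hv0, hq] at h1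
    simpa using h1

theorem sum_prod_mem_subspaceVariety {b : Fin n → ℕ} (hba : ∀ j, b j ≤ a j) {T : Type*}
    (S : Finset T) (κ : T → Ind b) (α : ∀ j, Fin (b j) → Fin (a j) → K) :
    (fun w : Ind a => ∑ k ∈ S, ∏ j, α j (κ k j) (w j)) ∈ subspaceVariety K a b := by
  have h : ∀ j, ∃ q : Submodule K (Fin (a j) → K),
      Submodule.span K (Set.range (α j)) ≤ q ∧ Module.finrank K q = b j := fun j =>
    Submodule.exists_le_finrank_eq _
      ((finrank_range_le_card (α j)).trans_eq (Fintype.card_fin _)) (by simpa using hba j)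
  choose q hq hq' using h
  refine ⟨q, hq', fun j w => ?_⟩
  have : (fun i => ∑ k ∈ S, ∏ l, α l (κ k l) (Function.update w j i l)) =
      ∑ k ∈ S, (∏ l ∈ univ.erase j, α l (κ k l) (w l)) • α j (κ k j) := by
    funext i
    rw [Finset.sum_apply]
    refine Finset.sum_congr rfl fun k _ => ?_
    rw [← Finset.mul_prod_erase _ _ (mem_univ j), Function.update_self, mul_comm,
      Pi.smul_apply, smul_eq_mul]
    congr 1
    refine Finset.prod_congr rfl fun l hl => ?_
    rw [Function.update_of_ne (Finset.ne_of_mem_erase hl)]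
  rw [this]
  exact (q j).sum_mem fun k _ => (q j).smul_mem _ (hq j (Submodule.subset_span ⟨_, rfl⟩))

theorem mem_subIdeal {b : Fin n → ℕ} {f : MvPolynomial (Ind a) K} :
    f ∈ subIdeal K a b ↔ ∀ T ∈ subspaceVariety K a b, eval T f = 0 := by
  simp [subIdeal, Submodule.mem_iInf, RingHom.mem_ker]

theorem oneVsRestMinors_subset_subIdeal (b : Fin n → ℕ) (j : Fin n) :
    oneVsRestMinors K a j (b j + 1) ⊆ subIdeal K a b := by
  rintro f ⟨ρ, γ, rfl⟩
  rw [SetLike.mem_coe, mem_subIdeal]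
  rintro T ⟨A', hA', hT⟩
  rw [RingHom.map_det]
  by_contra hdet
  have hli := Matrix.linearIndependent_cols_of_det_ne_zero hdet
  let v : Fin (b j + 1) → A' j := fun k => ⟨_, hT j (γ k)⟩
  have hv : LinearIndependent K v := by
    refine LinearIndependent.of_comp
      ((LinearMap.funLeft K K ρ).comp (A' j).subtype) ?_
    have heq : ⇑((LinearMap.funLeft K K ρ).comp (A' j).subtype) ∘ v = Matrix.col
        ((eval T).mapMatrix (Matrix.of fun i k : Fin (b j + 1) =>
          (X (Function.update (γ k) j (ρ i)) : MvPolynomial (Ind a) K))) := by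
      ext k i
      simp [v, Matrix.col, LinearMap.funLeft]
    rw [heq]
    exact hli
  have := hv.fintype_card_le_finrank
  rw [hA', Fintype.card_fin] at this
  omega

end

theorem sum_youngStab_conj {D ι : Type*} [Fintype D] [DecidableEq D] [Fintype ι]
    [DecidableEq ι] {C : ι → Type*} [∀ j, DecidableEq (C j)] {V : Type*} [AddCommMonoid V]
    (κ : ∀ j, D → C j) (h : ι → Perm D) (F : (ι → Perm D) → V) :
    ∑ σ ∈ youngStab κ, F (σ * h) = ∑ σ ∈ youngStab (wordAct κ h), F (h * σ) := by
  refine Finset.sum_bij' (fun σ _ => h⁻¹ * σ * h) (fun σ _ => h * σ * h⁻¹) ?_ ?_ ?_ ?_ ?_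
  · intro σ hσ
    rw [mem_youngStab] at hσ ⊢
    simp [wordAct, hσ]
  · intro σ hσ
    rw [mem_youngStab] at hσ ⊢
    intro j k
    simpa [wordAct] using hσ j ((h j)⁻¹ k)
  · intro σ _
    simp [mul_assoc]
  · intro σ _
    simp [mul_assoc]
  · intro σ _
    simp [mul_assoc]

theorem youngStab_eq_fin {D ι : Type*} [Fintype D] [DecidableEq D] [Fintype ι]
    [DecidableEq ι] {b : ι → ℕ} {κ : ι → D → ℕ} (hκ : ∀ j k, κ j k < b j) :
    youngStab κ = youngStab fun j k => (⟨κ j k, hκ j k⟩ : Fin (b j)) := by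
  ext σ
  simp [mem_youngStab]

theorem sum_permsOn_inv {D : Type*} [Fintype D] [DecidableEq D] {V : Type*} [AddCommGroup V]
    (S : Finset D) (F : Perm D → V) :
    ∑ τ ∈ permsOn S, (Perm.sign τ : ℤ) • F τ⁻¹ = ∑ τ ∈ permsOn S, (Perm.sign τ : ℤ) • F τ := by
  have hinv : ∀ τ ∈ permsOn S, τ⁻¹ ∈ permsOn S := by
    intro τ hτ
    rw [mem_permsOn] at hτ ⊢
    intro k hk
    rw [Perm.inv_eq_iff_eq, hτ k hk]
  refine Finset.sum_bij' (fun τ _ => τ⁻¹) (fun τ _ => τ⁻¹) hinv hinv ?_ ?_ ?_ <;> simp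

section

variable {K : Type} [Field K] {d : ℕ} {a b : Fin n → ℕ}

theorem isAddTorsionFree_of_charZero (K : Type*) [Field K] [CharZero K] (V : Type*)
    [AddCommGroup V] [Module K V] : IsAddTorsionFree V where
  nsmul_right_injective m hm x y h := by
    simp only [← Nat.cast_smul_eq_nsmul K] at h
    exact smul_right_injective V (Nat.cast_ne_zero.mpr hm) h

theorem eval_wordMonomial (T : Ind a → K) (w : ∀ j, Fin d → Fin (a j)) :
    eval T (wordMonomial K w) = ∏ k, T fun j => w j k := by
  simp [wordMonomial]

theorem MvPolynomial.IsHomogeneous.exists_sum_wordMonomial {f : MvPolynomial (Ind a) K}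
    (hf : f.IsHomogeneous d) :
    ∃ y : (∀ j, Fin d → Fin (a j)) → K, ∑ w, y w • wordMonomial K w = f := by
  rw [← Submodule.mem_span_range_iff_exists_fun K, f.as_sum]
  refine Submodule.sum_mem _ fun s hs => ?_
  rw [← mul_one (coeff s f), ← smul_eq_mul, ← smul_monomial]
  refine Submodule.smul_mem _ _ (Submodule.subset_span ?_)
  have hcard : Multiset.card (Finsupp.toMultiset s) = d := by
    rw [Finsupp.card_toMultiset, hf.degree_eq_sum_deg_support hs]
    rfl
  obtain ⟨l, hl⟩ := Quot.exists_rep (Finsupp.toMultiset s)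
  rw [← hl] at hcard
  obtain rfl : l.length = d := hcard
  refine ⟨fun j k => l.get k j, ?_⟩
  have h1 : (monomial s (1 : K)) = (Multiset.map X (Finsupp.toMultiset s)).prod := by
    rw [Finsupp.toMultiset_map, Finsupp.prod_toMultiset, Finsupp.prod_mapDomain_index, monomial_eq]
    all_goals simp [pow_add]
  rw [h1, ← hl]
  change ∏ k : Fin l.length, X (l.get k) = (l.map X).prod
  rw [← List.prod_ofFn]
  congr 1
  exact List.ofFn_getElem_eq_map l X

theorem MvPolynomial.IsHomogeneous.eval_smul {f : MvPolynomial (Ind a) K}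
    (hf : f.IsHomogeneous d) (t : K) (T : Ind a → K) :
    eval (t • T) f = eval T f * t ^ d := by
  obtain ⟨y, rfl⟩ := hf.exists_sum_wordMonomial
  simp only [map_sum, smul_eval, eval_wordMonomial, Finset.sum_mul]
  refine Finset.sum_congr rfl fun w _ => ?_
  simp only [Pi.smul_apply, smul_eq_mul, Finset.prod_mul_distrib]
  simp
  ring

theorem smul_mem_subspaceVariety {T : Ind a → K} (hT : T ∈ subspaceVariety K a b) (t : K) :
    t • T ∈ subspaceVariety K a b := by
  obtain ⟨A', h1, h2⟩ := hT
  exact ⟨A', h1, fun j w => (A' j).smul_mem t (h2 j w)⟩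

theorem homogeneousComponent_mem_subIdeal [Infinite K] {f : MvPolynomial (Ind a) K}
    (hf : f ∈ subIdeal K a b) (d : ℕ) : homogeneousComponent d f ∈ subIdeal K a b := by
  rw [mem_subIdeal] at hf ⊢
  intro T hT
  let p : Polynomial K := ∑ i ∈ range (f.totalDegree + 1),
    Polynomial.monomial i (eval T (homogeneousComponent i f))
  have hp : p = 0 := by
    refine Polynomial.funext fun t => ?_
    have h1 := hf _ (smul_mem_subspaceVariety hT t)
    rw [← sum_homogeneousComponent f, map_sum] at h1
    simp_rw [(homogeneousComponent_isHomogeneous _ f).eval_smul t T] at h1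
    simpa [p, Polynomial.eval_finsetSum] using h1
  have h2 : p.coeff d = 0 := by rw [hp, Polynomial.coeff_zero]
  by_cases hd : d < f.totalDegree + 1
  · simpa [p, Polynomial.finsetSum_coeff, Polynomial.coeff_monomial, hd] using h2
  · rw [homogeneousComponent_eq_zero _ _ (by omega), map_zero]

theorem sum_youngStab_eq_zero_of_mem_subIdeal (hba : ∀ j, b j ≤ a j)
    {y : (∀ j, Fin d → Fin (a j)) → K} (hy : ∑ w, y w • wordMonomial K w ∈ subIdeal K a b)
    (κ : ∀ j, Fin d → Fin (b j)) (u : ∀ j, Fin d → Fin (a j)) :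
    ∑ σ ∈ youngStab κ, ∑ τ : Perm (Fin d), y (wordAct (wordAct u σ) fun _ => τ) = 0 := by
  rw [← Submodule.mem_bot K]
  refine sum_youngStab_mem_of_forall_weight ⊥ κ
    (fun u => ∑ τ : Perm (Fin d), y (wordAct u fun _ => τ)) (fun α => ?_) u
  rw [Submodule.mem_bot]
  let Z : (∀ j, Fin d → Fin (a j)) → Matrix (Fin d) (Fin d) K := fun w =>
    Matrix.of fun k' k => ∏ j, α j (κ j k') (w j k)
  have h1 : ∑ w, (∏ j, ∏ k, α j (κ j k) (w j k)) • ∑ τ : Perm (Fin d), y (wordAct w fun _ => τ) =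
      ∑ w, y w * (Z w).permanent := by
    simp_rw [Matrix.permanent, smul_eq_mul, Finset.mul_sum]
    rw [Finset.sum_comm]
    refine Eq.trans ?_ Finset.sum_comm
    refine Finset.sum_congr rfl fun τ _ => ?_
    rw [← sum_wordAct (fun w => y w * ∏ k, Z w (τ k) k) fun _ => τ]
    refine Finset.sum_congr rfl fun w _ => ?_
    rw [mul_comm, Finset.prod_comm]
    congr 1
    rw [← Equiv.prod_comp τ]
    rfl
  rw [h1]
  simp_rw [Matrix.permanent_eq_sum_powerset, Finset.mul_sum]
  rw [Finset.sum_comm]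
  refine Finset.sum_eq_zero fun T _ => ?_
  have h2 := mem_subIdeal.mp hy _ (sum_prod_mem_subspaceVariety hba Tᶜ (fun k j => κ j k) α)
  simp only [map_sum, smul_eval, eval_wordMonomial] at h2
  rw [← mul_zero ((-1) ^ T.card), ← h2, Finset.mul_sum]
  refine Finset.sum_congr rfl fun w _ => ?_
  rw [mul_left_comm]
  rfl

end

section

variable {K : Type} [Field K] [CharZero K] {d : ℕ} {a b : Fin n → ℕ}

theorem mem_of_isAnnihilated_mod {I : Ideal (MvPolynomial (Ind a) K)}
    {Φ : (Fin n → Perm (Fin d)) → MvPolynomial (Ind a) K}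
    (young : ∀ κ : ∀ j, Fin d → Fin (b j), ∀ g, ∑ σ ∈ youngStab κ, Φ (g * σ) ∈ I)
    (anti : ∀ (j : Fin n) (S : Finset (Fin d)), S.card = b j + 1 → ∀ g h,
      ∑ τ ∈ permsOn S, (Perm.sign τ : ℤ) • Φ (g * factorPerm j τ * h) ∈ I)
    (g : Fin n → Perm (Fin d)) : Φ g ∈ I := by
  have := isAddTorsionFree_of_charZero K (MvPolynomial (Ind a) K ⧸ I)
  rw [← Ideal.Quotient.eq_zero_iff_mem]
  refine IsAnnihilated.eq_zero (b := b) (Φ := fun g => Ideal.Quotient.mk I (Φ g)) ⟨?_, ?_⟩ g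
  · intro κ hκ g h
    rw [youngStab_eq_fin hκ, ← map_sum, Ideal.Quotient.eq_zero_iff_mem]
    simp_rw [mul_assoc g]
    rw [sum_youngStab_conj _ h fun s => Φ (g * s)]
    simp_rw [← mul_assoc g]
    exact young _ _
  · intro j S hS g h
    simp_rw [← map_zsmul]
    rw [← map_sum, Ideal.Quotient.eq_zero_iff_mem]
    exact anti j S hS g h

theorem MvPolynomial.IsHomogeneous.mem_span_minors_of_mem_subIdeal (hba : ∀ j, b j ≤ a j)
    {f : MvPolynomial (Ind a) K} (hf : f.IsHomogeneous d) (hfI : f ∈ subIdeal K a b) :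
    f ∈ Ideal.span (⋃ j : Fin n, oneVsRestMinors K a j (b j + 1)) := by
  obtain ⟨y, rfl⟩ := hf.exists_sum_wordMonomial
  let x : (∀ j, Fin d → Fin (a j)) → K := fun w => ∑ τ : Perm (Fin d), y (wordAct w fun _ => τ)
  have hx : ∑ w, x (wordAct w 1) • wordMonomial K w =
      ((d.factorial : K)) • ∑ w, y w • wordMonomial K w := by
    simp_rw [x, wordAct_one, Finset.sum_smul]
    rw [Finset.sum_comm]
    have : ∀ τ : Perm (Fin d), ∑ w, y (wordAct w fun _ => τ) • wordMonomial K w =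
        ∑ w, y w • wordMonomial K w := fun τ => by
      rw [← sum_wordAct (fun w => y w • wordMonomial K w) fun _ => τ]
      simp_rw [wordMonomial_diag]
    simp_rw [this]
    rw [Finset.sum_const, card_univ, Fintype.card_perm, Fintype.card_fin,
      Nat.cast_smul_eq_nsmul]
  rw [← Submodule.restrictScalars_mem K,
    ← Submodule.smul_mem_iff _ (Nat.cast_ne_zero.mpr d.factorial_ne_zero : (d.factorial : K) ≠ 0),
    ← hx, Submodule.restrictScalars_mem]
  refine mem_of_isAnnihilated_mod (b := b)
    (Φ := fun g => ∑ w, x (wordAct w g) • wordMonomial K w) ?_ ?_ 1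
  · intro κ g
    rw [Finset.sum_comm]
    simp_rw [← Finset.sum_smul, wordAct_mul]
    refine Ideal.sum_mem _ fun w _ => ?_
    rw [sum_youngStab_eq_zero_of_mem_subIdeal hba hfI κ, zero_smul]
    exact Ideal.zero_mem _
  · intro j S hS g h
    have h1 : ∀ τ : Perm (Fin d),
        ∑ w, x (wordAct w (g * factorPerm j τ * h)) • wordMonomial K w =
          ∑ w, x w • wordMonomial K (wordAct w (h⁻¹ * factorPerm j τ⁻¹ * g⁻¹)) := fun τ => by
      rw [← sum_wordAct (fun w => x w • wordMonomial K _) (g * factorPerm j τ * h)]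
      refine Finset.sum_congr rfl fun w _ => ?_
      rw [← wordAct_mul w, factorPerm_inv]
      simp [mul_assoc, wordAct_one]
    simp_rw [h1, Finset.smul_sum]
    rw [Finset.sum_comm]
    refine Ideal.sum_mem _ fun w _ => ?_
    simp_rw [smul_comm _ (x w)]
    rw [← Finset.smul_sum, sum_permsOn_inv S fun τ =>
      wordMonomial K (wordAct w (h⁻¹ * factorPerm j τ * g⁻¹))]
    refine Submodule.smul_of_tower_mem _ _ ?_
    refine Ideal.span_mono ?_ (sum_permsOn_wordMonomial_mul_mem w j S h⁻¹ g⁻¹)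
    rw [hS]
    exact Set.subset_iUnion (fun j => oneVsRestMinors K a j (b j + 1)) j

theorem subIdeal_eq_span_minors (hba : ∀ j, b j ≤ a j) :
    subIdeal K a b = Ideal.span (⋃ j : Fin n, oneVsRestMinors K a j (b j + 1)) := by
  refine le_antisymm (fun f hf => ?_) ?_
  · rw [← sum_homogeneousComponent f]
    exact Ideal.sum_mem _ fun d _ => MvPolynomial.IsHomogeneous.mem_span_minors_of_mem_subIdeal hba
      (homogeneousComponent_isHomogeneous d f) (homogeneousComponent_mem_subIdeal hf d)
  · rw [Ideal.span_le, Set.iUnion_subset_iff]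
    exact oneVsRestMinors_subset_subIdeal b

theorem oneVsRestMinors_subset_zero_of_lt {K : Type} [Field K] {a : Fin n → ℕ} {j : Fin n} {m : ℕ}
    (hm : a j < m) : oneVsRestMinors K a j m ⊆ {0} := by
  rintro f ⟨ρ, γ, rfl⟩
  obtain ⟨i, i', hne, heq⟩ := Fintype.exists_ne_map_eq_of_card_lt ρ (by simpa using hm)
  exact Matrix.det_zero_of_row_eq hne (by ext1 k; simp [heq])

theorem oneVsRestMinors_subset_of_bounded {I : Ideal (MvPolynomial (Ind a) K)}
    (hI : ∀ j, ∀ f ∈ Submodule.span K (oneVsRestMinors K a j (b j + 1)),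
      f ∈ pullbackSpan K a (lengthBound a b j) → f ∈ I) (j : Fin n) :
    oneVsRestMinors K a j (b j + 1) ⊆ I := by
  induction j using WellFoundedLT.induction with
  | _ j ih =>
  intro f hf
  obtain ⟨w, rfl⟩ := exists_sum_perm_wordMonomial hf
  have key := mem_of_isAnnihilated_mod (d := b j + 1) (b := lengthBound a b j) (I := I)
    (Φ := fun g => ∑ τ : Perm (Fin (b j + 1)),
      (Perm.sign τ : ℤ) • wordMonomial K (wordAct w (g * factorPerm j τ))) ?_ ?_ 1
  · simpa only [one_mul, SetLike.mem_coe] using key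
  · intro κ g
    refine hI j _ ?_ ?_
    · exact Submodule.sum_mem _ fun σ _ =>
        Submodule.subset_span (sum_perm_wordMonomial_mem (wordAct w (g * σ)) j)
    · rw [Finset.sum_comm]
      refine Submodule.sum_mem _ fun τ _ => ?_
      have h1 := sum_youngStab_wordMonomial_mem (K := K) (wordAct κ (factorPerm j τ))
        (wordAct w (g * factorPerm j τ))
      simp_rw [← wordAct_mul w, mul_assoc g] at h1
      rw [← sum_youngStab_conj κ (factorPerm j τ)
        fun s => wordMonomial K (wordAct w (g * s))] at h1
      simpa only [Finset.smul_sum, mul_assoc g] using zsmul_mem h1 (Perm.sign τ : ℤ)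
  · intro i S hS g h
    have hle : lengthBound a b j i ≤ b j := by
      have := card_le_univ S
      rw [hS, Fintype.card_fin] at this
      omega
    simp_rw [Finset.smul_sum]
    rw [Finset.sum_comm]
    refine Ideal.sum_mem _ fun τ' _ => ?_
    simp_rw [smul_comm _ (Perm.sign τ' : ℤ)]
    rw [← Finset.smul_sum]
    refine zsmul_mem ?_ _
    simp_rw [mul_assoc _ h]
    have hmem := sum_permsOn_wordMonomial_mul_mem (K := K) w i S g (h * factorPerm j τ')
    rw [hS] at hmem
    refine Ideal.span_le.mpr ?_ hmem
    rcases lt_trichotomy i j with hij | rfl | hij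
    · by_cases hb : b i < b j
      · have : lengthBound a b j i = b i := by simp [lengthBound, hij, hb]
        rw [this]
        exact ih i hij
      · have h1 : lengthBound a b j i = b i + 1 := by simp [lengthBound, hij, hb]
        omega
    · simp [lengthBound] at hle
    · have : lengthBound a b j i = a i := by simp [lengthBound, hij.not_gt, hij.ne']
      rw [this]
      refine (oneVsRestMinors_subset_zero_of_lt (Nat.lt_succ_self _)).trans ?_
      simp

end

end

/-- **Theorem 3.1 (Landsberg–Weyman), generators of the ideal.**  Let
`b₁ ≤ ... ≤ b_n`, `b_j ≤ a_j`.  The ideal of `Sub_{b₁,...,b_n}` is generated in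
degrees `b_j + 1` by the irreducible modules occurring among the `(b_j+1)×(b_j+1)`
minors of the `j`-th one-versus-rest flattening whose partitions obey the length bound
`lengthBound` (this submodule being realized as the intersection of the span of the
minors with the span of the pullbacks from spaces of the bounded dimensions).  In
particular, if all `b_i = r`, the ideal of `Sub_{r,...,r}` is generated in degree
`r + 1` by the `(r+1)×(r+1)` minors of the one-versus-rest flattenings. -/
theorem subspaceVariety_ideal_generators (K : Type) [Field K] [CharZero K]
    (n : ℕ) (a b : Fin n → ℕ) (hba : ∀ j, b j ≤ a j) (hmono : Monotone b) :
    subIdeal K a b =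
      Ideal.span (⋃ j : Fin n,
        ((Submodule.span K (oneVsRestMinors K a j (b j + 1)) ⊓
          pullbackSpan K a (lengthBound a b j) :
            Submodule K (MvPolynomial (Ind a) K)) : Set (MvPolynomial (Ind a) K))) ∧
    ∀ r : ℕ, (∀ i, b i = r) →
      subIdeal K a b =
        Ideal.span (⋃ j : Fin n, oneVsRestMinors K a j (r + 1)) := by
  refine ⟨(subIdeal_eq_span_minors hba).trans (le_antisymm ?_ ?_), fun r hr => ?_⟩
  · rw [Ideal.span_le, Set.iUnion_subset_iff]
    exact oneVsRestMinors_subset_of_bounded fun j f h1 h2 =>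
      Ideal.subset_span (Set.mem_iUnion_of_mem j ⟨h1, h2⟩)
  · rw [Ideal.span_le, Set.iUnion_subset_iff]
    intro j f hf
    have hle : Submodule.span K (oneVsRestMinors K a j (b j + 1)) ≤
        (Ideal.span (⋃ j : Fin n, oneVsRestMinors K a j (b j + 1))).restrictScalars K :=
      Submodule.span_le.mpr ((Set.subset_iUnion (fun j => oneVsRestMinors K a j (b j + 1)) j).trans
        Ideal.subset_span)
    exact hle hf.1
  · rw [subIdeal_eq_span_minors hba]
    simp_rw [hr]
end
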